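/- For a function $T$ between metric spaces let $\mathrm{Lip}(T,x)=\lim_{\varepsilon\to0^+}\mathrm{Lip}(T|_{B(x,\varepsilon)})\in[0,\infty]$ denote the local Lipschitz constant at $x$. For a differentiable $f:\mathbb{R}^n\to\mathbb{R}$ and $1\le s\le\infty$ put $$\mathrm{Lip}_s(f)=\sup_{x\in\mathbb{R}^n}|\nabla f(x)|_s,\qquad \mathrm{Lip}_s^\sharp(f)=\Big(\sum_{i=1}^n\sup_{x\in\mathbb{R}^n}\Big|\frac{\partial f}{\partial x_i}(x)\Big|^s\Big)^{1/s},$$ where $|\cdot|_s$ is the $\ell_s^n$ norm, with the usual interpretation (a maximum over $i$) when $s=\infty$; these quantities take values in $[0,\infty]$. The quantile function of a probability measure on $\mathbb{R}$ with cumulative distribution function $F$ is $F^{-1}(s)=\inf\{t\in\mathbb{R}:F(t)\ge s\}$, $0<s<1$, and $\Phi$ is the standard normal cumulative distribution function. Let $0<q<1$. There exist constants $c_q,C_q>0$, depending only on $q$, such that the following holds. Let $n\in\mathbb{N}$ and let $\mu_1,\dots,\mu_n$ be probability measures on $\mathbb{R}$ with cumulative distribution functions $F_i$ and quantile functions $F_i^{-1}$,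 such that for all $i$ and all $s\in\mathbb{R}$ $$\mathrm{Lip}(F_i^{-1}\circ\Phi,s)\le(1+|s|)^{-1+2/q}.$$ Let $f:\mathbb{R}^n\to\mathbb{R}$ be differentiable, let $X=(X_i)_{i=1}^n$ be a vector of independent random variables with $X_i$ distributed according to $\mu_i$, and let $\mathbb{M}f(X)$ be any median of $f(X)$. Then for all $t>0$, $$\mathbb{P}\{|f(X)-\mathbb{M}f(X)|>t\}\le2\exp\Big(-c_q\min\Big\{\Big(\frac{t}{\mathrm{Lip}_2^\sharp(f)}\Big)^2,\Big(\frac{t}{\mathrm{Lip}_\infty^\sharp(f)}\Big)^q\Big\}\Big)$$ and $$\mathbb{P}\Big\{|f(X)-\mathbb{M}f(X)|>C_q\Big(\log\Big(e+\frac{n}{t^{-2+4/q}}\Big)\Big)^{1/q-1/2}\big(t\,\mathrm{Lip}_2(f)+t^{2/q}\,\mathrm{Lip}_\infty(f)\big)\Big\}\le2\exp(-t^2/2),$$ with the conventions $t/0=\infty$, $t/\infty=0$ and $\exp(-\infty)=0$. -/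

import Mathlib

open MeasureTheory ProbabilityTheory Filter
open scoped ENNReal NNReal Topology

noncomputable section

/-- The least Lipschitz constant of the restriction of `g` to `S` (`∞` if it is not Lipschitz). -/
def lipConstOn {α β : Type*} [PseudoEMetricSpace α] [PseudoEMetricSpace β]
    (g : α → β) (S : Set α) : ℝ≥0∞ :=
  ⨅ (K : ℝ≥0) (_ : LipschitzOnWith K g S), (K : ℝ≥0∞)

/-- The local Lipschitz constant `Lip(g, x)`, the limit as `ε → 0⁺` of the Lipschitz constant of
`g` on the ball `B(x, ε)`. That constant is monotone in `ε`, so the limit is an infimum;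
see `tendsto_lipConstOn_ball`. -/
def localLip {α β : Type*} [PseudoMetricSpace α] [PseudoMetricSpace β] (g : α → β) (x : α) :
    ℝ≥0∞ :=
  sInf ((fun ε : ℝ => lipConstOn g (Metric.ball x ε)) '' Set.Ioi 0)

theorem tendsto_lipConstOn_ball {α β : Type*} [PseudoMetricSpace α] [PseudoMetricSpace β]
    (g : α → β) (x : α) :
    Tendsto (fun ε : ℝ => lipConstOn g (Metric.ball x ε)) (𝓝[>] 0) (𝓝 (localLip g x)) := by
  have hmono : Monotone (fun ε : ℝ => lipConstOn g (Metric.ball x ε)) := by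
    intro a b hab
    exact le_iInf₂ fun K hK => iInf₂_le K (hK.mono (Metric.ball_subset_ball hab))
  exact hmono.tendsto_nhdsGT 0

/-- The quantile function `F⁻¹(s) = inf {t : F(t) ≥ s}` of a probability measure on `ℝ` with
cumulative distribution function `F` (only used for `0 < s < 1`). -/
def quantile (ν : Measure ℝ) (s : ℝ) : ℝ :=
  sInf {t : ℝ | s ≤ cdf ν t}

/-- The standard normal cumulative distribution function `Φ`. -/
def stdNormalCDF (x : ℝ) : ℝ :=
  cdf (gaussianReal 0 1) x

/-- The partial derivative `∂f/∂xᵢ` at `x`. -/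
def partialDeriv {n : ℕ} (f : (Fin n → ℝ) → ℝ) (i : Fin n) (x : Fin n → ℝ) : ℝ :=
  fderiv ℝ f x (Pi.single i 1)

/-- `Lip_s(f) = sup_x |∇f(x)|_s`, possibly infinite. -/
def lipGrad {n : ℕ} (s : ℝ≥0∞) (f : (Fin n → ℝ) → ℝ) : ℝ≥0∞ :=
  if s = ∞ then ⨆ x : Fin n → ℝ, ⨆ i : Fin n, ‖partialDeriv f i x‖ₑ
  else ⨆ x : Fin n → ℝ, (∑ i : Fin n, ‖partialDeriv f i x‖ₑ ^ s.toReal) ^ (1 / s.toReal)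

/-- `Lip_s^♯(f) = (∑ᵢ sup_x |∂f/∂xᵢ(x)|^s)^{1/s}`, a maximum over `i` if `s = ∞`; possibly
infinite. -/
def lipSharp {n : ℕ} (s : ℝ≥0∞) (f : (Fin n → ℝ) → ℝ) : ℝ≥0∞ :=
  if s = ∞ then ⨆ i : Fin n, ⨆ x : Fin n → ℝ, ‖partialDeriv f i x‖ₑ
  else (∑ i : Fin n, ⨆ x : Fin n → ℝ, ‖partialDeriv f i x‖ₑ ^ s.toReal) ^ (1 / s.toReal)

/-- `m` is a median of the random variable `Y`. -/
def IsMedian {Ω : Type*} [MeasurableSpace Ω] (P : Measure Ω) (Y : Ω → ℝ) (m : ℝ) : Prop :=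
  1 / 2 ≤ P {ω | Y ω ≤ m} ∧ 1 / 2 ≤ P {ω | m ≤ Y ω}

end

lemma le_cdf_quantile (ν : Measure ℝ) [IsProbabilityMeasure ν] {s : ℝ} (h1 : s < 1) :
    s ≤ cdf ν (quantile ν s) := by
  have hne : {t : ℝ | s ≤ cdf ν t}.Nonempty := by
    obtain ⟨t, ht⟩ := ((tendsto_cdf_atTop ν).eventually (lt_mem_nhds h1)).exists
    exact ⟨t, ht.le⟩
  have hr : Tendsto (cdf ν) (𝓝[>] (quantile ν s)) (𝓝 (cdf ν (quantile ν s))) :=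
    ((cdf ν).right_continuous _).mono_left (nhdsWithin_mono _ Set.Ioi_subset_Ici_self)
  refine ge_of_tendsto hr ?_
  filter_upwards [self_mem_nhdsWithin] with t ht
  obtain ⟨u, hu, hut⟩ := exists_lt_of_csInf_lt hne ht
  exact le_trans hu (monotone_cdf ν hut.le)

lemma quantile_le_iff (ν : Measure ℝ) [IsProbabilityMeasure ν] {s : ℝ} (h0 : 0 < s) (h1 : s < 1)
    (a : ℝ) : quantile ν s ≤ a ↔ s ≤ cdf ν a := by
  refine ⟨fun h => (le_cdf_quantile ν h1).trans (monotone_cdf ν h), fun h => csInf_le ?_ h⟩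
  obtain ⟨b, hb⟩ := ((tendsto_cdf_atBot ν).eventually (gt_mem_nhds h0)).exists
  refine ⟨b, fun t ht => ?_⟩
  by_contra hlt
  exact absurd (ht.trans (monotone_cdf ν (not_le.1 hlt).le)) (not_le.2 hb)

lemma stdNormalCDF_strictMono : StrictMono stdNormalCDF := by
  intro a b hab
  have hpos : 0 < gaussianReal 0 1 (Set.Ioc a b) := by
    rw [pos_iff_ne_zero]
    intro h
    have := gaussianReal_absolutelyContinuous' 0 one_ne_zero h
    simp only [Real.volume_Ioc, ENNReal.ofReal_eq_zero] at this
    linarith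
  rw [← measure_cdf (gaussianReal 0 1), StieltjesFunction.measure_Ioc, ENNReal.ofReal_pos] at hpos
  exact sub_pos.1 hpos

lemma stdNormalCDF_continuous : Continuous stdNormalCDF := by
  refine continuous_iff_continuousAt.2 fun a => ?_
  change ContinuousAt (cdf (gaussianReal 0 1)) a
  rw [(monotone_cdf _).continuousAt_iff_leftLim_eq_rightLim, StieltjesFunction.rightLim_eq]
  have h : gaussianReal 0 1 {a} = 0 := by
    have := nullSingletonClass_gaussianReal (μ := 0) (v := 1) one_ne_zero
    exact measure_singleton a
  rw [← measure_cdf (gaussianReal 0 1), StieltjesFunction.measure_singleton,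
    ENNReal.ofReal_eq_zero] at h
  exact le_antisymm ((monotone_cdf _).leftLim_le le_rfl) (by linarith)

lemma stdNormalCDF_pos (x : ℝ) : 0 < stdNormalCDF x :=
  (cdf_nonneg _ (x - 1)).trans_lt (stdNormalCDF_strictMono (by linarith))

lemma stdNormalCDF_lt_one (x : ℝ) : stdNormalCDF x < 1 :=
  (stdNormalCDF_strictMono (by linarith : x < x + 1)).trans_le (cdf_le_one _ _)

lemma gaussianReal_stdNormalCDF_le {p : ℝ} (h0 : 0 ≤ p) (h1 : p ≤ 1) :
    gaussianReal 0 1 {x | stdNormalCDF x ≤ p} = ENNReal.ofReal p := by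
  rcases h0.eq_or_lt with rfl | h0
  · have : {x | stdNormalCDF x ≤ 0} = ∅ := by
      ext x; simpa using stdNormalCDF_pos x
    simp [this]
  rcases h1.eq_or_lt with rfl | h1
  · have : {x | stdNormalCDF x ≤ 1} = Set.univ := by
      ext x; simpa using (stdNormalCDF_lt_one x).le
    simp [this]
  obtain ⟨a, ha⟩ := ((tendsto_cdf_atBot (gaussianReal 0 1)).eventually (gt_mem_nhds h0)).exists
  obtain ⟨b, hb⟩ := ((tendsto_cdf_atTop (gaussianReal 0 1)).eventually (lt_mem_nhds h1)).exists
  obtain ⟨x, rfl⟩ := mem_range_of_exists_le_of_exists_ge stdNormalCDF_continuous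
    ⟨a, ha.le⟩ ⟨b, hb.le⟩
  have : {y | stdNormalCDF y ≤ stdNormalCDF x} = Set.Iic x := by
    ext y; simp [stdNormalCDF_strictMono.le_iff_le]
  rw [this, stdNormalCDF, ofReal_cdf]

lemma measurable_quantile_stdNormalCDF (ν : Measure ℝ) [IsProbabilityMeasure ν] :
    Measurable (fun x => quantile ν (stdNormalCDF x)) := by
  refine measurable_of_Iic fun a => ?_
  have : (fun x => quantile ν (stdNormalCDF x)) ⁻¹' Set.Iic a
      = {x | stdNormalCDF x ≤ cdf ν a} := by
    ext x; exact quantile_le_iff ν (stdNormalCDF_pos x) (stdNormalCDF_lt_one x) a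
  rw [this]
  exact measurableSet_le stdNormalCDF_continuous.measurable measurable_const

/-- The increasing transport of the standard Gaussian measure to `ν`. -/
lemma map_quantile_stdNormalCDF (ν : Measure ℝ) [IsProbabilityMeasure ν] :
    (gaussianReal 0 1).map (fun x => quantile ν (stdNormalCDF x)) = ν := by
  have hm := measurable_quantile_stdNormalCDF ν
  have := Measure.isProbabilityMeasure_map (μ := gaussianReal 0 1) hm.aemeasurable
  refine Measure.ext_of_Iic _ _ fun a => ?_
  rw [Measure.map_apply hm measurableSet_Iic, ← ofReal_cdf,
    ← gaussianReal_stdNormalCDF_le (cdf_nonneg ν a) (cdf_le_one ν a)]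
  congr 1
  ext x
  exact quantile_le_iff ν (stdNormalCDF_pos x) (stdNormalCDF_lt_one x) a

/-- Replacing a median by an independent copy. -/
lemma IsMedian.measure_lt_abs_sub_le {Ω : Type*} [MeasurableSpace Ω] {P : Measure Ω}
    [IsProbabilityMeasure P] {Y : Ω → ℝ} (hY : Measurable Y) {m : ℝ} (hm : IsMedian P Y m) {u : ℝ}
    (hu : 0 ≤ u) :
    P {ω | u < |Y ω - m|} ≤ 2 * (P.prod P) {z | u < |Y z.1 - Y z.2|} := by
  have hup : P {ω | m + u < Y ω} * (1 / 2) ≤ (P.prod P) {z | u < Y z.1 - Y z.2} := by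
    calc _ ≤ P {ω | m + u < Y ω} * P {ω | Y ω ≤ m} := by gcongr; exact hm.1
      _ = (P.prod P) ({ω | m + u < Y ω} ×ˢ {ω | Y ω ≤ m}) := (Measure.prod_prod _ _).symm
      _ ≤ _ := measure_mono fun z hz => by
          have h1 : m + u < Y z.1 := hz.1
          have h2 : Y z.2 ≤ m := hz.2
          change u < Y z.1 - Y z.2
          linarith
  have hdown : P {ω | Y ω < m - u} * (1 / 2) ≤ (P.prod P) {z | Y z.1 - Y z.2 < -u} := by
    calc _ ≤ P {ω | Y ω < m - u} * P {ω | m ≤ Y ω} := by gcongr; exact hm.2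
      _ = (P.prod P) ({ω | Y ω < m - u} ×ˢ {ω | m ≤ Y ω}) := (Measure.prod_prod _ _).symm
      _ ≤ _ := measure_mono fun z hz => by
          have h1 : Y z.1 < m - u := hz.1
          have h2 : m ≤ Y z.2 := hz.2
          change Y z.1 - Y z.2 < -u
          linarith
  have hsplit : P {ω | u < |Y ω - m|} ≤ P {ω | m + u < Y ω} + P {ω | Y ω < m - u} := by
    refine (measure_mono fun ω hω => ?_).trans (measure_union_le _ _)
    rcases lt_abs.1 (show u < |Y ω - m| from hω) with h | h
    · exact Or.inl (show m + u < Y ω by linarith)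
    · exact Or.inr (show Y ω < m - u by linarith)
  have hjoin : (P.prod P) {z | u < Y z.1 - Y z.2} + (P.prod P) {z | Y z.1 - Y z.2 < -u}
      ≤ (P.prod P) {z | u < |Y z.1 - Y z.2|} := by
    rw [← measure_union]
    · refine measure_mono fun z hz => ?_
      rcases hz with h | h
      · have h : u < Y z.1 - Y z.2 := h
        exact (lt_abs.2 (Or.inl h) : u < |Y z.1 - Y z.2|)
      · have h : Y z.1 - Y z.2 < -u := h
        exact (lt_abs.2 (Or.inr (by linarith)) : u < |Y z.1 - Y z.2|)
    · rw [Set.disjoint_left]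
      intro z h1 h2
      have h1 : u < Y z.1 - Y z.2 := h1
      have h2 : Y z.1 - Y z.2 < -u := h2
      linarith
    · exact measurableSet_lt (by fun_prop) measurable_const
  calc P {ω | u < |Y ω - m|} = 2 * (P {ω | u < |Y ω - m|} * (1 / 2)) := by
        rw [mul_comm (P _), ← mul_assoc, one_div, ENNReal.mul_inv_cancel two_ne_zero
          ENNReal.ofNat_ne_top, one_mul]
    _ ≤ 2 * ((P {ω | m + u < Y ω} + P {ω | Y ω < m - u}) * (1 / 2)) := by gcongr
    _ ≤ _ := by
        rw [add_mul]
        gcongr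
        exact (add_le_add hup hdown).trans hjoin

/-- The standard Gaussian measure on `ℝⁿ`. -/
noncomputable abbrev gaussPi (n : ℕ) : Measure (Fin n → ℝ) :=
  Measure.pi (fun _ : Fin n => gaussianReal 0 1)

lemma gaussPi_eq_map_stdGaussian (n : ℕ) :
    gaussPi n = (stdGaussian (EuclideanSpace ℝ (Fin n))).map
      (PiLp.continuousLinearEquiv 2 ℝ (fun _ : Fin n => ℝ)).toContinuousLinearMap := by
  rw [← map_pi_eq_stdGaussian, Measure.map_map (by fun_prop) (by fun_prop)]
  exact Measure.map_id.symm

instance gaussPi_isGaussian (n : ℕ) : IsGaussian (gaussPi n) := by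
  rw [gaussPi_eq_map_stdGaussian]
  infer_instance

lemma integral_id_gaussPi (n : ℕ) : ∫ x, id x ∂(gaussPi n) = 0 := by
  have h := gaussPi_eq_map_stdGaussian n
  set e := (PiLp.continuousLinearEquiv 2 ℝ (fun _ : Fin n => ℝ)).toContinuousLinearMap
  rw [h, integral_map (by fun_prop) (by fun_prop)]
  have := e.integral_comp_id_comm (μ := stdGaussian (EuclideanSpace ℝ (Fin n)))
    IsGaussian.integrable_id
  simpa using this

lemma map_rotation_gaussPi (n : ℕ) (θ : ℝ) :
    ((gaussPi n).prod (gaussPi n)).map (ContinuousLinearMap.rotation θ)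
      = (gaussPi n).prod (gaussPi n) :=
  IsGaussian.map_rotation_eq_self (integral_id_gaussPi n) θ

lemma lintegral_prod_gaussPi {n : ℕ} {h : Fin n → ℝ → ℝ≥0∞} (hh : ∀ i, Measurable (h i)) :
    ∫⁻ x, ∏ i, h i (x i) ∂(gaussPi n) = ∏ i, ∫⁻ x, h i x ∂(gaussianReal 0 1) := by
  rw [lintegral_prod_eq_prod_lintegral_of_indepFun Finset.univ (fun i (x : Fin n → ℝ) => h i (x i))
    (iIndepFun_pi fun i => (hh i).aemeasurable) (fun i => (hh i).comp (measurable_pi_apply i))]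
  refine Finset.prod_congr rfl fun i _ => ?_
  exact (measurePreserving_eval (fun _ : Fin n => gaussianReal 0 1) i).lintegral_comp (hh i)

lemma lintegral_exp_mul_gaussianReal (a : ℝ) :
    ∫⁻ x, ENNReal.ofReal (Real.exp (a * x)) ∂(gaussianReal 0 1)
      = ENNReal.ofReal (Real.exp (a ^ 2 / 2)) := by
  rw [← ofReal_integral_eq_lintegral_ofReal (integrable_exp_mul_gaussianReal a)
    (ae_of_all _ fun x => (Real.exp_pos _).le)]
  have := mgf_gaussianReal (p := gaussianReal 0 1) (X := id) (μ := 0) (v := 1) (by simp) a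
  simp only [mgf, id] at this
  rw [this]
  simp

lemma lintegral_exp_sum_gaussPi {n : ℕ} (v : Fin n → ℝ) :
    ∫⁻ y, ENNReal.ofReal (Real.exp (∑ i, v i * y i)) ∂(gaussPi n)
      = ENNReal.ofReal (Real.exp ((∑ i, v i ^ 2) / 2)) := by
  simp_rw [Real.exp_sum, ENNReal.ofReal_prod_of_nonneg fun i _ => (Real.exp_pos _).le]
  rw [lintegral_prod_gaussPi (h := fun i x => ENNReal.ofReal (Real.exp (v i * x)))
    (fun i => by fun_prop)]
  simp_rw [lintegral_exp_mul_gaussianReal]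
  rw [← ENNReal.ofReal_prod_of_nonneg fun i _ => (Real.exp_pos _).le, ← Real.exp_sum,
    Finset.sum_div]

/-- Even moments of a Gaussian linear form. -/
lemma lintegral_linear_pow_gaussPi {n : ℕ} (v : Fin n → ℝ) {k : ℕ} (hk : k ≠ 0) :
    ∫⁻ y, ‖∑ i, v i * y i‖ₑ ^ (2 * k) ∂(gaussPi n)
      ≤ 2 * ENNReal.ofReal ((2 * Real.exp 1 * k * ∑ i, v i ^ 2) ^ k) := by
  set V := ∑ i, v i ^ 2 with hV
  have hV0 : 0 ≤ V := Finset.sum_nonneg fun i _ => sq_nonneg _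
  rcases hV0.eq_or_lt with h0 | hpos
  · have : ∀ i, v i = 0 := fun i => by
      have := (Finset.sum_eq_zero_iff_of_nonneg fun i _ => sq_nonneg (v i)).1 h0.symm i
        (Finset.mem_univ i)
      simpa using this
    simp [this, hk]
  have hk0 : (0 : ℝ) < k := by positivity
  set l := √(2 * k / V) with hl
  have hl0 : 0 < l := by positivity
  have hl2 : l ^ 2 = 2 * k / V := Real.sq_sqrt (by positivity)
  set c : ℝ := (2 * k) ^ (2 * k) / l ^ (2 * k) with hc
  have hc0 : 0 ≤ c := by positivity
  have hpt : ∀ s : ℝ, ‖s‖ₑ ^ (2 * k) ≤ ENNReal.ofReal c * (ENNReal.ofReal (Real.exp (l * s))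
      + ENNReal.ofReal (Real.exp (-l * s))) := by
    intro s
    rw [← ENNReal.ofReal_add (by positivity) (by positivity), ← ENNReal.ofReal_mul hc0,
      ← ofReal_norm, ← ENNReal.ofReal_pow (norm_nonneg _)]
    refine ENNReal.ofReal_le_ofReal ?_
    have h1 : (l * |s|) ^ (2 * k) / (2 * k).factorial ≤ Real.exp (l * |s|) :=
      Real.pow_div_factorial_le_exp _ (by positivity) _
    have h2 : Real.exp (l * |s|) ≤ Real.exp (l * s) + Real.exp (-l * s) := by
      rcases abs_cases s with ⟨h, _⟩ | ⟨h, _⟩ <;> rw [h]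
      · linarith [Real.exp_pos (-l * s)]
      · rw [mul_neg, ← neg_mul]; linarith [Real.exp_pos (l * s)]
    have h3 : ((2 * k).factorial : ℝ) ≤ (2 * k) ^ (2 * k) := by
      exact_mod_cast Nat.factorial_le_pow (2 * k)
    rw [div_le_iff₀ (by positivity), mul_pow] at h1
    rw [Real.norm_eq_abs, hc, div_mul_eq_mul_div, le_div_iff₀ (by positivity)]
    calc |s| ^ (2 * k) * l ^ (2 * k) ≤ Real.exp (l * |s|) * (2 * k).factorial := by linarith
      _ ≤ (Real.exp (l * s) + Real.exp (-l * s)) * (2 * k) ^ (2 * k) := by gcongr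
      _ = _ := mul_comm _ _
  have hexp : ∀ a : ℝ, a ^ 2 = l ^ 2 →
      ∫⁻ y, ENNReal.ofReal (Real.exp (a * ∑ i, v i * y i)) ∂(gaussPi n)
        = ENNReal.ofReal (Real.exp k) := by
    intro a ha
    have := lintegral_exp_sum_gaussPi (fun i => a * v i)
    simp_rw [mul_pow, ← Finset.mul_sum, mul_assoc] at this
    simp_rw [← Finset.mul_sum] at this
    rw [this, ha, ← hV, hl2]
    congr 2
    field_simp
  calc _ ≤ ∫⁻ y, ENNReal.ofReal c * (ENNReal.ofReal (Real.exp (l * ∑ i, v i * y i))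
      + ENNReal.ofReal (Real.exp (-l * ∑ i, v i * y i))) ∂(gaussPi n) :=
        lintegral_mono fun y => hpt _
    _ = ENNReal.ofReal c * (ENNReal.ofReal (Real.exp k) + ENNReal.ofReal (Real.exp k)) := by
        rw [lintegral_const_mul _ (by fun_prop), lintegral_add_left (by fun_prop),
          hexp l rfl, hexp (-l) (by ring)]
    _ = 2 * ENNReal.ofReal ((2 * Real.exp 1 * k * V) ^ k) := by
        rw [← two_mul, mul_left_comm, ← ENNReal.ofReal_mul hc0]
        congr 2
        rw [hc, pow_mul l, hl2, pow_mul, ← Real.exp_one_pow k]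
        rw [← div_pow, ← mul_pow]
        congr 1
        field_simp

lemma lintegral_pow_le_measure_univ_mul {α : Type*} [MeasurableSpace α] (μ : Measure α)
    {g : α → ℝ≥0∞} (hg : AEMeasurable g μ) {p : ℕ} (hp : p ≠ 0) :
    (∫⁻ a, g a ∂μ) ^ p ≤ μ Set.univ ^ (p - 1) * ∫⁻ a, g a ^ p ∂μ := by
  have h := eLpNorm_le_eLpNorm_mul_rpow_measure_univ (p := 1) (q := p) (μ := μ) (f := g)
    (by exact_mod_cast Nat.one_le_iff_ne_zero.2 hp) hg.aestronglyMeasurable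
  rw [eLpNorm_one_eq_lintegral_enorm,
    eLpNorm_eq_lintegral_rpow_enorm_toReal (by exact_mod_cast hp) (by simp)] at h
  simp only [enorm_eq_self, ENNReal.toReal_one, ENNReal.toReal_natCast, ENNReal.rpow_natCast] at h
  have hp' : (p : ℝ) ≠ 0 := by exact_mod_cast hp
  calc _ ≤ ((∫⁻ a, g a ^ p ∂μ) ^ (1 / (p : ℝ)) * μ Set.univ ^ (1 / 1 - 1 / (p : ℝ))) ^ p := by
        gcongr
    _ = _ := by
        rw [mul_pow, ← ENNReal.rpow_natCast, ← ENNReal.rpow_natCast, ← ENNReal.rpow_mul,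
          ← ENNReal.rpow_mul, ← ENNReal.rpow_natCast, one_div_mul_cancel hp', ENNReal.rpow_one,
          mul_comm, Nat.cast_sub (Nat.one_le_iff_ne_zero.2 hp)]
        congr 2
        field_simp
        simp

lemma LocallyLipschitz.ae_differentiableAt_real {T : ℝ → ℝ} (hT : LocallyLipschitz T) :
    ∀ᵐ x : ℝ, DifferentiableAt ℝ T x := by
  have h : ∀ N : ℕ, ∀ᵐ x : ℝ, x ∈ Set.Icc (-(N : ℝ)) N →
      DifferentiableWithinAt ℝ T (Set.Icc (-(N : ℝ)) N) x := fun N => by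
    obtain ⟨K, hK⟩ := (hT.locallyLipschitzOn (s := Set.Icc (-(N : ℝ)) N)
      ).exists_lipschitzOnWith_of_compact isCompact_Icc
    exact hK.ae_differentiableWithinAt_of_mem_real
  filter_upwards [ae_all_iff.2 h] with x hx
  obtain ⟨N, hN⟩ := exists_nat_gt |x|
  rw [abs_lt] at hN
  exact (hx N ⟨hN.1.le, hN.2.le⟩).differentiableAt (Icc_mem_nhds hN.1 hN.2)

lemma fderiv_apply_eq_sum_partialDeriv {n : ℕ} (f : (Fin n → ℝ) → ℝ) (x v : Fin n → ℝ) :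
    fderiv ℝ f x v = ∑ i, v i * partialDeriv f i x := by
  conv_lhs => rw [← Finset.univ_sum_single v]
  rw [map_sum]
  refine Finset.sum_congr rfl fun i _ => ?_
  rw [partialDeriv, ← smul_eq_mul, ← map_smul, ← Pi.single_smul, smul_eq_mul, mul_one]

/-- The gradient of `x ↦ f (T₁ x₁, …, Tₙ xₙ)`. -/
noncomputable def transportGrad {n : ℕ} (f : (Fin n → ℝ) → ℝ) (T : Fin n → ℝ → ℝ) (x : Fin n → ℝ)
    (i : Fin n) : ℝ :=
  deriv (T i) (x i) * partialDeriv f i (fun j => T j (x j))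

lemma measurable_transportGrad {n : ℕ} (f : (Fin n → ℝ) → ℝ) {T : Fin n → ℝ → ℝ}
    (hT : ∀ i, LocallyLipschitz (T i)) (i : Fin n) :
    Measurable (fun x => transportGrad f T x i) := by
  refine ((measurable_deriv (T i)).comp (measurable_pi_apply i)).mul ?_
  refine (measurable_fderiv_apply_const ℝ f (Pi.single i 1)).comp ?_
  exact measurable_pi_lambda _ fun j =>
    (hT j).continuous.measurable.comp (measurable_pi_apply j)

lemma enorm_sub_le_lintegral_rotation {n : ℕ} {f : (Fin n → ℝ) → ℝ} (hf : Differentiable ℝ f)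
    {K : ℝ≥0} (hK : LipschitzWith K f) {T : Fin n → ℝ → ℝ} (hT : ∀ i, LocallyLipschitz (T i))
    (x y : Fin n → ℝ)
    (hd : ∀ᵐ θ : ℝ, ∀ i, DifferentiableAt ℝ (T i) (Real.cos θ * x i + Real.sin θ * y i)) :
    ‖f (fun i => T i (y i)) - f (fun i => T i (x i))‖ₑ ≤
      ∫⁻ θ in Set.Ioc 0 (Real.pi / 2), ‖∑ i, transportGrad f T
        (fun j => Real.cos θ * x j + Real.sin θ * y j) i *
          (-Real.sin θ * x i + Real.cos θ * y i)‖ₑ := by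
  set g : ℝ → ℝ := fun θ => f (fun i => T i (Real.cos θ * x i + Real.sin θ * y i)) with hg
  have hLi : ∀ i, ∃ L : ℝ≥0, LipschitzOnWith L
      (fun θ => T i (Real.cos θ * x i + Real.sin θ * y i)) (Set.uIcc 0 (Real.pi / 2)) := by
    intro i
    have h1 : LocallyLipschitz (fun θ => Real.cos θ * x i + Real.sin θ * y i) := by
      refine ContDiff.locallyLipschitz (𝕂 := ℝ) ?_
      exact (Real.contDiff_cos.mul contDiff_const).add (Real.contDiff_sin.mul contDiff_const)
    exact (((hT i).comp h1).locallyLipschitzOn).exists_lipschitzOnWith_of_compact isCompact_uIcc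
  choose L hL using hLi
  have hgL : LipschitzOnWith (K * ∑ i, L i) g (Set.uIcc 0 (Real.pi / 2)) := by
    refine hK.comp_lipschitzOnWith (LipschitzOnWith.of_dist_le_mul fun a ha b hb => ?_)
    refine (dist_pi_le_iff (by positivity)).2 fun i => ((hL i).dist_le_mul a ha b hb).trans ?_
    gcongr
    exact Finset.single_le_sum (f := L) (fun _ _ => zero_le) (Finset.mem_univ i)
  have hftc := hgL.absolutelyContinuousOnInterval.integral_deriv_eq_sub
  have hends : g (Real.pi / 2) - g 0 = f (fun i => T i (y i)) - f (fun i => T i (x i)) := by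
    simp [hg]
  have hder : ∀ᵐ θ : ℝ, deriv g θ = ∑ i, transportGrad f T
        (fun j => Real.cos θ * x j + Real.sin θ * y j) i *
          (-Real.sin θ * x i + Real.cos θ * y i) := by
    filter_upwards [hd] with θ hθ
    have h1 : HasDerivAt (fun θ => fun i => T i (Real.cos θ * x i + Real.sin θ * y i))
        (fun i => deriv (T i) (Real.cos θ * x i + Real.sin θ * y i) *
          (-Real.sin θ * x i + Real.cos θ * y i)) θ := by
      refine hasDerivAt_pi.2 fun i => ?_
      have h2 : HasDerivAt (fun θ => Real.cos θ * x i + Real.sin θ * y i)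
          (-Real.sin θ * x i + Real.cos θ * y i) θ :=
        ((Real.hasDerivAt_cos θ).mul_const _).add ((Real.hasDerivAt_sin θ).mul_const _)
      exact (hθ i).hasDerivAt.comp θ h2
    have h3 := (hf (fun i => T i (Real.cos θ * x i + Real.sin θ * y i))).hasFDerivAt.comp_hasDerivAt
      θ h1
    rw [show deriv g θ = _ from h3.deriv, fderiv_apply_eq_sum_partialDeriv]
    refine Finset.sum_congr rfl fun i _ => ?_
    simp only [transportGrad]
    ring
  rw [← hends, ← hftc, intervalIntegral.integral_of_le (by positivity)]
  refine (enorm_integral_le_lintegral_enorm _).trans (le_of_eq ?_)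
  refine lintegral_congr_ae ?_
  filter_upwards [ae_restrict_of_ae hder] with θ hθ
  rw [hθ]

lemma ae_ae_differentiableAt_rotation {n : ℕ} {T : Fin n → ℝ → ℝ}
    (hT : ∀ i, LocallyLipschitz (T i)) :
    ∀ᵐ z ∂((gaussPi n).prod (gaussPi n)), ∀ᵐ θ : ℝ,
      ∀ i, DifferentiableAt ℝ (T i) (Real.cos θ * z.1 i + Real.sin θ * z.2 i) := by
  refine (Measure.ae_ae_comm ?_).2 (ae_of_all _ fun θ => ?_)
  · have : {w : ((Fin n → ℝ) × (Fin n → ℝ)) × ℝ | ∀ i, DifferentiableAt ℝ (T i)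
        (Real.cos w.2 * w.1.1 i + Real.sin w.2 * w.1.2 i)} =
        ⋂ i, (fun w : ((Fin n → ℝ) × (Fin n → ℝ)) × ℝ =>
          Real.cos w.2 * w.1.1 i + Real.sin w.2 * w.1.2 i) ⁻¹' {a | DifferentiableAt ℝ (T i) a} := by
      ext w; simp
    rw [this]
    exact MeasurableSet.iInter fun i =>
      (by fun_prop : Measurable _) (measurableSet_of_differentiableAt ℝ (T i))
  · rw [ae_all_iff]
    intro i
    have h1 : ∀ᵐ a ∂(gaussianReal 0 1), DifferentiableAt ℝ (T i) a :=
      (gaussianReal_absolutelyContinuous 0 one_ne_zero).ae_le (hT i).ae_differentiableAt_real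
    have h2 : ∀ᵐ x ∂(gaussPi n), DifferentiableAt ℝ (T i) (x i) :=
      (Measure.quasiMeasurePreserving_eval (fun _ : Fin n => gaussianReal 0 1) i).ae h1
    have h3 : ∀ᵐ z ∂((gaussPi n).prod (gaussPi n)), DifferentiableAt ℝ (T i) (z.1 i) :=
      Measure.quasiMeasurePreserving_fst.ae h2
    rw [← map_rotation_gaussPi n θ] at h3
    exact ae_of_ae_map (f := ContinuousLinearMap.rotation θ) (by fun_prop) h3

/-- Moment form of the Maurey–Pisier inequality. -/
lemma lintegral_enorm_sub_pow_le {n : ℕ} {f : (Fin n → ℝ) → ℝ} (hf : Differentiable ℝ f)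
    {K : ℝ≥0} (hK : LipschitzWith K f) {T : Fin n → ℝ → ℝ} (hT : ∀ i, LocallyLipschitz (T i))
    {p : ℕ} (hp : p ≠ 0) :
    ∫⁻ z, ‖f (fun i => T i (z.1 i)) - f (fun i => T i (z.2 i))‖ₑ ^ p
        ∂((gaussPi n).prod (gaussPi n)) ≤
      ENNReal.ofReal (Real.pi / 2) ^ p * ∫⁻ z, ‖∑ i, transportGrad f T z.1 i * z.2 i‖ₑ ^ p
        ∂((gaussPi n).prod (gaussPi n)) := by
  set H : (Fin n → ℝ) × (Fin n → ℝ) → ℝ≥0∞ :=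
    fun z => ‖∑ i, transportGrad f T z.1 i * z.2 i‖ₑ ^ p with hH
  have hHm : Measurable H := by
    refine Measurable.pow_const (Measurable.enorm ?_) p
    refine Finset.measurable_sum _ fun i _ => ?_
    exact ((measurable_transportGrad f hT i).comp measurable_fst).mul (by fun_prop)
  have hrot : Measurable (fun w : ((Fin n → ℝ) × (Fin n → ℝ)) × ℝ =>
      ContinuousLinearMap.rotation w.2 w.1) := by
    simp only [ContinuousLinearMap.rotation_apply]
    fun_prop
  have hpath : ∀ᵐ z ∂((gaussPi n).prod (gaussPi n)),
      ‖f (fun i => T i (z.1 i)) - f (fun i => T i (z.2 i))‖ₑ ^ p ≤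
        ENNReal.ofReal (Real.pi / 2) ^ (p - 1) * ∫⁻ θ in Set.Ioc 0 (Real.pi / 2),
          H (ContinuousLinearMap.rotation θ z) := by
    filter_upwards [ae_ae_differentiableAt_rotation hT] with z hz
    have h1 := enorm_sub_le_lintegral_rotation hf hK hT z.1 z.2 hz
    rw [enorm_sub_rev]
    refine (pow_le_pow_left' h1 p).trans ?_
    have hm : Measurable (fun θ : ℝ => ‖∑ i, transportGrad f T
        (fun j => Real.cos θ * z.1 j + Real.sin θ * z.2 j) i *
          (-Real.sin θ * z.1 i + Real.cos θ * z.2 i)‖ₑ) := by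
      refine Measurable.enorm (Finset.measurable_sum _ fun i _ => ?_)
      exact Measurable.mul ((measurable_transportGrad f hT i).comp
        (g := fun x => transportGrad f T x i)
        (f := fun (θ : ℝ) j => Real.cos θ * z.1 j + Real.sin θ * z.2 j) (by fun_prop)) (by fun_prop)
    refine (lintegral_pow_le_measure_univ_mul _ hm.aemeasurable hp).trans (le_of_eq ?_)
    rw [Measure.restrict_apply_univ, Real.volume_Ioc, sub_zero]
    rfl
  refine (lintegral_mono_ae hpath).trans ?_
  have hrm : Measurable (fun w : ((Fin n → ℝ) × (Fin n → ℝ)) × ℝ =>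
    H (ContinuousLinearMap.rotation w.2 w.1)) := hHm.comp hrot
  rw [lintegral_const_mul _ hrm.lintegral_prod_right', lintegral_lintegral_swap hrm.aemeasurable]
  have hconst : ∀ θ : ℝ, ∫⁻ z, H (ContinuousLinearMap.rotation θ z)
      ∂((gaussPi n).prod (gaussPi n)) = ∫⁻ z, H z ∂((gaussPi n).prod (gaussPi n)) := fun θ => by
    conv_rhs => rw [← map_rotation_gaussPi n θ]
    rw [lintegral_map hHm (by fun_prop)]
  simp_rw [hconst]
  rw [lintegral_const, Measure.restrict_apply_univ, Real.volume_Ioc, sub_zero]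
  refine le_of_eq ?_
  rw [mul_comm (∫⁻ z, H z ∂_), ← mul_assoc, ← pow_succ, Nat.sub_add_cancel
    (Nat.one_le_iff_ne_zero.2 hp)]

lemma lintegral_enorm_sub_pow_two_mul_le {n : ℕ} {f : (Fin n → ℝ) → ℝ} (hf : Differentiable ℝ f)
    {K : ℝ≥0} (hK : LipschitzWith K f) {T : Fin n → ℝ → ℝ} (hT : ∀ i, LocallyLipschitz (T i))
    {k : ℕ} (hk : k ≠ 0) :
    ∫⁻ z, ‖f (fun i => T i (z.1 i)) - f (fun i => T i (z.2 i))‖ₑ ^ (2 * k)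
        ∂((gaussPi n).prod (gaussPi n)) ≤
      2 * ENNReal.ofReal (14 * k) ^ k *
        ∫⁻ x, ENNReal.ofReal (∑ i, transportGrad f T x i ^ 2) ^ k ∂(gaussPi n) := by
  have hGm : ∀ i, Measurable (fun x => transportGrad f T x i) := measurable_transportGrad f hT
  have hm : Measurable (fun z : (Fin n → ℝ) × (Fin n → ℝ) =>
      ‖∑ i, transportGrad f T z.1 i * z.2 i‖ₑ ^ (2 * k)) := by
    refine Measurable.pow_const (Measurable.enorm ?_) _
    refine Finset.measurable_sum _ fun i _ => ?_
    exact ((hGm i).comp measurable_fst).mul (by fun_prop)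
  have hWm : Measurable (fun x => ENNReal.ofReal (∑ i, transportGrad f T x i ^ 2) ^ k) := by
    fun_prop
  have hnn : ∀ x, 0 ≤ ∑ i, transportGrad f T x i ^ 2 :=
    fun x => Finset.sum_nonneg fun i _ => sq_nonneg _
  refine (lintegral_enorm_sub_pow_le hf hK hT (mul_ne_zero two_ne_zero hk)).trans ?_
  rw [lintegral_prod _ hm.aemeasurable]
  calc _ ≤ ENNReal.ofReal (Real.pi / 2) ^ (2 * k) * ∫⁻ x, 2 * ENNReal.ofReal
          ((2 * Real.exp 1 * k * ∑ i, transportGrad f T x i ^ 2) ^ k) ∂(gaussPi n) := by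
        exact mul_le_mul_right (lintegral_mono fun x =>
          lintegral_linear_pow_gaussPi (fun i => transportGrad f T x i) hk) _
    _ = 2 * (ENNReal.ofReal (Real.pi / 2) ^ 2 * ENNReal.ofReal (2 * Real.exp 1 * k)) ^ k *
        ∫⁻ x, ENNReal.ofReal (∑ i, transportGrad f T x i ^ 2) ^ k ∂(gaussPi n) := by
        have : ∀ w : ℝ, 0 ≤ w → ENNReal.ofReal ((2 * Real.exp 1 * k * w) ^ k) =
            ENNReal.ofReal (2 * Real.exp 1 * k) ^ k * ENNReal.ofReal w ^ k := fun w hw => by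
          rw [← mul_pow, ← ENNReal.ofReal_mul (by positivity), ENNReal.ofReal_pow (by positivity)]
        simp_rw [fun x => this _ (hnn x)]
        rw [lintegral_const_mul _ (by fun_prop), lintegral_const_mul _ hWm, mul_pow, ← pow_mul]
        ring
    _ ≤ _ := by
        gcongr
        rw [← ENNReal.ofReal_pow (by positivity), ← ENNReal.ofReal_mul (by positivity)]
        refine ENNReal.ofReal_le_ofReal ?_
        have h1 := Real.pi_lt_d2
        have h2 := Real.exp_one_lt_d9
        have h3 : (Real.pi / 2) ^ 2 ≤ 1.575 ^ 2 := by
          have := Real.pi_pos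
          gcongr; linarith
        calc (Real.pi / 2) ^ 2 * (2 * Real.exp 1 * (k : ℝ)) ≤ 1.575 ^ 2 * (2 * 2.7182818286 * (k : ℝ)) := by
              gcongr
          _ ≤ 14 * (k : ℝ) := by
              rw [← mul_assoc]; gcongr; norm_num

/-- The exponential series truncated at order `k`. -/
noncomputable def truncExp (k : ℕ) (x : ℝ≥0∞) : ℝ≥0∞ :=
  ∑ j ∈ Finset.range (k + 1), (j.factorial : ℝ≥0∞)⁻¹ * x ^ j

lemma measurable_truncExp (k : ℕ) : Measurable (truncExp k) := by
  unfold truncExp; fun_prop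

lemma choose_mul_factorial_eq {m j : ℕ} (h : j ≤ m) :
    (m.choose j : ℝ≥0∞) * (m - j).factorial = m.factorial * (j.factorial : ℝ≥0∞)⁻¹ := by
  have hj : (j.factorial : ℝ≥0∞) ≠ 0 := by exact_mod_cast j.factorial_ne_zero
  have h1 : ((m.choose j * j.factorial * (m - j).factorial : ℕ) : ℝ≥0∞) = m.factorial := by
    rw [Nat.choose_mul_factorial_mul_factorial h]
  rw [← h1]
  push_cast
  rw [mul_right_comm, mul_assoc _ (j.factorial : ℝ≥0∞), ENNReal.mul_inv_cancel hj
    (ENNReal.natCast_ne_top _), mul_one]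

lemma sum_pow_le_prod_truncExp {ι : Type*} (s : Finset ι) (x : ι → ℝ≥0∞) (k : ℕ) :
    ∀ m ≤ k, (∑ i ∈ s, x i) ^ m ≤ m.factorial * ∏ i ∈ s, truncExp k (x i) := by
  classical
  induction s using Finset.induction_on with
  | empty =>
    intro m _
    rcases Nat.eq_zero_or_pos m with rfl | hm
    · simp
    · simp [hm.ne']
  | insert a s ha ih =>
    intro m hm
    rw [Finset.sum_insert ha, Finset.prod_insert ha, add_pow]
    set Q := ∏ i ∈ s, truncExp k (x i)
    calc _ ≤ ∑ j ∈ Finset.range (m + 1), m.factorial * ((j.factorial : ℝ≥0∞)⁻¹ * x a ^ j) * Q := by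
          refine Finset.sum_le_sum fun j hj => ?_
          have hj : j ≤ m := Nat.lt_succ_iff.1 (Finset.mem_range.1 hj)
          calc x a ^ j * (∑ i ∈ s, x i) ^ (m - j) * (m.choose j : ℝ≥0∞)
              ≤ x a ^ j * ((m - j).factorial * Q) * (m.choose j : ℝ≥0∞) := by
                gcongr
                exact ih _ ((Nat.sub_le m j).trans hm)
            _ = x a ^ j * Q * ((m.choose j : ℝ≥0∞) * (m - j).factorial) := by ring
            _ = _ := by rw [choose_mul_factorial_eq hj]; ring
      _ = m.factorial * ((∑ j ∈ Finset.range (m + 1), (j.factorial : ℝ≥0∞)⁻¹ * x a ^ j) * Q) := by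
          rw [← Finset.sum_mul, ← Finset.mul_sum, mul_assoc]
      _ ≤ _ := by
          gcongr
          exact Finset.sum_le_sum_of_subset (Finset.range_mono (by omega))

lemma rpow_le_rpow_self_mul_exp {u a : ℝ} (hu : 0 < u) (ha : 0 < a) :
    u ^ a ≤ a ^ a * Real.exp u := by
  rw [Real.rpow_def_of_pos hu, Real.rpow_def_of_pos ha, ← Real.exp_add, Real.exp_le_exp]
  have h := Real.log_le_sub_one_of_pos (div_pos hu ha)
  rw [Real.log_div hu.ne' ha.ne'] at h
  have h2 : a * (Real.log u - Real.log a) ≤ a * (u / a - 1) := by gcongr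
  rw [mul_sub, mul_sub, mul_div_cancel₀ _ ha.ne'] at h2
  linarith

lemma lintegral_exp_sq_gaussianReal :
    ∫⁻ x, ENNReal.ofReal (Real.exp (3 / 8 * x ^ 2)) ∂(gaussianReal 0 1) = 2 := by
  rw [gaussianReal_of_var_ne_zero 0 one_ne_zero,
    lintegral_withDensity_eq_lintegral_mul _ (measurable_gaussianPDF 0 1) (by fun_prop)]
  have h : ∀ x : ℝ, (gaussianPDF 0 1 * fun x => ENNReal.ofReal (Real.exp (3 / 8 * x ^ 2))) x
      = ENNReal.ofReal ((√(2 * Real.pi))⁻¹ * Real.exp (-(1 / 8) * x ^ 2)) := fun x => by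
    rw [Pi.mul_apply, gaussianPDF, ← ENNReal.ofReal_mul (gaussianPDFReal_nonneg _ _ _),
      gaussianPDFReal, mul_assoc, ← Real.exp_add]
    congr 3
    · simp
    · simp
      ring
  simp_rw [h]
  rw [← ofReal_integral_eq_lintegral_ofReal
    ((integrable_exp_neg_mul_sq (by norm_num)).const_mul _) (ae_of_all _ fun x => by positivity),
    integral_const_mul, integral_gaussian]
  rw [← Real.sqrt_inv, ← Real.sqrt_mul (by positivity)]
  have : (2 * Real.pi)⁻¹ * (Real.pi / (1 / 8)) = 2 ^ 2 := by
    field_simp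
    norm_num
  rw [this, Real.sqrt_sq (by norm_num)]
  simp

/-- The weight `(1 + |x|) ^ (2 β)` restricted to `|x| ≥ A`. -/
noncomputable def tailWeight (β A x : ℝ) : ℝ≥0∞ :=
  if A ≤ |x| then ENNReal.ofReal ((1 + |x|) ^ (2 * β)) else 0

lemma measurable_tailWeight (β A : ℝ) : Measurable (tailWeight β A) := by
  unfold tailWeight
  refine Measurable.ite (measurableSet_le measurable_const (by fun_prop)) ?_ measurable_const
  fun_prop

lemma lintegral_tailWeight_pow {β A : ℝ} (hβ : 0 < β) (hA : 0 ≤ A) {j : ℕ} (hj : j ≠ 0) :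
    ∫⁻ x, tailWeight β A x ^ j ∂(gaussianReal 0 1)
      ≤ ENNReal.ofReal (4 * Real.exp (-A ^ 2 / 8) * (8 * β * j) ^ (β * j)) := by
  have hj0 : (0 : ℝ) < j := by positivity
  set c : ℝ := Real.exp (1 / 4) * Real.exp (-A ^ 2 / 8) * (8 * β * j) ^ (β * j) with hc
  have hc0 : 0 ≤ c := by positivity
  have hpt : ∀ x : ℝ, tailWeight β A x ^ j
      ≤ ENNReal.ofReal c * ENNReal.ofReal (Real.exp (3 / 8 * x ^ 2)) := by
    intro x
    unfold tailWeight
    split_ifs with h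
    swap
    · simp [hj]
    rw [← ENNReal.ofReal_mul hc0, ← ENNReal.ofReal_pow (by positivity)]
    refine ENNReal.ofReal_le_ofReal ?_
    have hx0 : 0 < 1 + |x| := by positivity
    have h1 : ((1 + |x|) ^ (2 * β)) ^ j = 8 ^ (β * j) * ((1 + |x|) ^ 2 / 8) ^ (β * j) := by
      rw [← Real.mul_rpow (by norm_num) (by positivity), ← Real.rpow_natCast, ← Real.rpow_mul hx0.le,
        mul_div_cancel₀ _ (by norm_num), ← Real.rpow_natCast (1 + |x|) 2, ← Real.rpow_mul hx0.le]
      congr 1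
      push_cast
      ring
    have h2 := rpow_le_rpow_self_mul_exp (u := (1 + |x|) ^ 2 / 8) (a := β * j) (by positivity)
      (by positivity)
    have h3 : Real.exp ((1 + |x|) ^ 2 / 8) ≤ Real.exp (1 / 4) * Real.exp (-A ^ 2 / 8) *
        Real.exp (3 / 8 * x ^ 2) := by
      rw [← Real.exp_add, ← Real.exp_add, Real.exp_le_exp]
      have h4 : A ^ 2 ≤ |x| ^ 2 := by gcongr
      have h5 := sq_abs x
      nlinarith [sq_nonneg (|x| - 1)]
    calc ((1 + |x|) ^ (2 * β)) ^ j
        ≤ 8 ^ (β * j) * ((β * j) ^ (β * j) * Real.exp ((1 + |x|) ^ 2 / 8)) := by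
          rw [h1]; gcongr
      _ = (8 * β * j) ^ (β * j) * Real.exp ((1 + |x|) ^ 2 / 8) := by
          rw [← mul_assoc, ← Real.mul_rpow (by norm_num) (by positivity), mul_assoc 8 β]
      _ ≤ (8 * β * j) ^ (β * j) * (Real.exp (1 / 4) * Real.exp (-A ^ 2 / 8) *
        Real.exp (3 / 8 * x ^ 2)) := by gcongr
      _ = _ := by rw [hc]; ring
  refine (lintegral_mono hpt).trans ?_
  rw [lintegral_const_mul _ (by fun_prop), lintegral_exp_sq_gaussianReal,
    show (2 : ℝ≥0∞) = ENNReal.ofReal 2 by simp, ← ENNReal.ofReal_mul hc0]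
  refine ENNReal.ofReal_le_ofReal ?_
  have h6 : Real.exp (1 / 4) ≤ 2 := by
    have h : Real.exp (1 / 4) ≤ Real.exp (Real.log 2) :=
      Real.exp_le_exp.2 (by linarith [Real.log_two_gt_d9])
    rwa [Real.exp_log (by norm_num)] at h
  calc c * 2 = 2 * Real.exp (1 / 4) * (Real.exp (-A ^ 2 / 8) * (8 * β * j) ^ (β * j)) := by
        rw [hc]; ring
    _ ≤ 2 * 2 * (Real.exp (-A ^ 2 / 8) * (8 * β * j) ^ (β * j)) := by gcongr
    _ = _ := by ring

/-- Growth rate of the moments of the weights. -/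
noncomputable def weightRate (β : ℝ) : ℝ := (8 * β) ^ β * Real.exp 1 * 2 ^ (β - 1)

lemma weightRate_pos {β : ℝ} (hβ : 0 < β) : 0 < weightRate β := by
  unfold weightRate; positivity

lemma moment_coeff_le {β : ℝ} (hβ : 1 ≤ β) {j k : ℕ} (hjk : j + 1 ≤ k) :
    (8 * β * (j + 1 : ℕ)) ^ (β * (j + 1 : ℕ)) ≤
      (j + 1).factorial * (weightRate β ^ (j + 1) * ((k : ℝ) ^ (β - 1)) ^ j) := by
  have hβ0 : 0 < β := by linarith
  set m := j + 1 with hm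
  have hm0 : (0 : ℝ) < m := by positivity
  have hk0 : (0 : ℝ) ≤ k := by positivity
  have h1 : (8 * β * m) ^ (β * m) = ((8 * β) ^ β) ^ m * ((m : ℝ) ^ m * ((m : ℝ) ^ m) ^ (β - 1)) := by
    rw [Real.mul_rpow (by positivity) hm0.le, Real.rpow_mul (by positivity), Real.rpow_natCast,
      mul_comm β (m : ℝ), Real.rpow_mul hm0.le, Real.rpow_natCast]
    congr 1
    rw [← Real.rpow_one_add' (by positivity) (by linarith)]
    congr 1
    ring
  have h2 : (m : ℝ) ^ m ≤ Real.exp 1 ^ m * m.factorial := by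
    have := Real.pow_div_factorial_le_exp (m : ℝ) hm0.le m
    rwa [div_le_iff₀ (by positivity), ← Real.exp_one_pow] at this
  have h3 : ((m : ℝ) ^ m) ^ (β - 1) ≤ (2 ^ (β - 1)) ^ m * ((k : ℝ) ^ (β - 1)) ^ j := by
    have h4 : (m : ℝ) ^ m ≤ 2 ^ m * (k : ℝ) ^ j := by
      conv_lhs => rw [hm, pow_succ', ← hm]
      have h5 : (m : ℝ) ≤ 2 ^ m := by exact_mod_cast (Nat.lt_two_pow_self (n := m)).le
      have h6 : (m : ℝ) ≤ k := by exact_mod_cast hjk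
      gcongr
    calc _ ≤ (2 ^ m * (k : ℝ) ^ j) ^ (β - 1) :=
          Real.rpow_le_rpow (by positivity) h4 (by linarith)
      _ = _ := by
          rw [Real.mul_rpow (by positivity) (by positivity), ← Real.rpow_natCast 2,
            ← Real.rpow_natCast (k : ℝ), ← Real.rpow_mul (by norm_num), ← Real.rpow_mul hk0,
            mul_comm (m : ℝ), mul_comm (j : ℝ), Real.rpow_mul (by norm_num), Real.rpow_mul hk0,
            Real.rpow_natCast, Real.rpow_natCast]
  calc _ ≤ ((8 * β) ^ β) ^ m * ((Real.exp 1 ^ m * m.factorial) *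
      ((2 ^ (β - 1)) ^ m * ((k : ℝ) ^ (β - 1)) ^ j)) := by rw [h1]; gcongr
    _ = _ := by rw [weightRate, mul_pow, mul_pow]; ring

lemma lintegral_truncExp_tailWeight_le {β A : ℝ} (hβ : 1 ≤ β) (hA : 0 ≤ A) (k : ℕ) {w : ℝ}
    (hw0 : 0 ≤ w) (hw : w * weightRate β * (k : ℝ) ^ (β - 1) ≤ 1 / 2) :
    ∫⁻ x, truncExp k (ENNReal.ofReal w * tailWeight β A x) ∂(gaussianReal 0 1)
      ≤ ENNReal.ofReal (Real.exp (8 * weightRate β * Real.exp (-A ^ 2 / 8) * w)) := by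
  have hβ0 : 0 < β := by linarith
  have hD := weightRate_pos hβ0
  have hm := measurable_tailWeight β A
  set D := weightRate β
  set ε := Real.exp (-A ^ 2 / 8) with hε
  set R := (k : ℝ) ^ (β - 1)
  have hR : 0 ≤ R := by positivity
  unfold truncExp
  rw [lintegral_finsetSum _ fun j _ => by fun_prop, Finset.sum_range_succ']
  have hterm : ∀ j ∈ Finset.range k, ∫⁻ x, ((j + 1).factorial : ℝ≥0∞)⁻¹ *
      (ENNReal.ofReal w * tailWeight β A x) ^ (j + 1) ∂(gaussianReal 0 1)
      ≤ ENNReal.ofReal (4 * ε * (w * D) * (1 / 2) ^ j) := by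
    intro j hj
    simp_rw [mul_pow, ← mul_assoc]
    rw [lintegral_const_mul _ (by fun_prop)]
    have hfac : ((j + 1).factorial : ℝ≥0∞)⁻¹ = ENNReal.ofReal ((j + 1).factorial : ℝ)⁻¹ := by
      rw [ENNReal.ofReal_inv_of_pos (by positivity), ENNReal.ofReal_natCast]
    calc _ ≤ ENNReal.ofReal ((j + 1).factorial : ℝ)⁻¹ * ENNReal.ofReal w ^ (j + 1) *
          ENNReal.ofReal (4 * ε * (8 * β * (j + 1 : ℕ)) ^ (β * (j + 1 : ℕ))) := by
          rw [hfac]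
          gcongr
          exact lintegral_tailWeight_pow hβ0 hA (Nat.succ_ne_zero j)
      _ = ENNReal.ofReal (((j + 1).factorial : ℝ)⁻¹ * w ^ (j + 1) *
          (4 * ε * (8 * β * (j + 1 : ℕ)) ^ (β * (j + 1 : ℕ)))) := by
          rw [← ENNReal.ofReal_pow hw0, ← ENNReal.ofReal_mul (by positivity),
            ← ENNReal.ofReal_mul (by positivity)]
      _ ≤ _ := by
          refine ENNReal.ofReal_le_ofReal ?_
          calc _ ≤ ((j + 1).factorial : ℝ)⁻¹ * w ^ (j + 1) *
                (4 * ε * ((j + 1).factorial * (D ^ (j + 1) * R ^ j))) := by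
                gcongr
                exact moment_coeff_le hβ (Finset.mem_range.1 hj)
            _ = 4 * ε * (w * D) * (w * D * R) ^ j := by
                have : ((j + 1).factorial : ℝ) ≠ 0 := by positivity
                field_simp
                ring
            _ ≤ 4 * ε * (w * D) * (1 / 2) ^ j :=
                mul_le_mul_of_nonneg_left (pow_le_pow_left₀ (by positivity) hw j) (by positivity)
            _ = _ := by ring
  have hsum : ∑ j ∈ Finset.range k, ∫⁻ x, ((j + 1).factorial : ℝ≥0∞)⁻¹ *
      (ENNReal.ofReal w * tailWeight β A x) ^ (j + 1) ∂(gaussianReal 0 1)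
      ≤ ENNReal.ofReal (8 * D * ε * w) := by
    refine (Finset.sum_le_sum hterm).trans ?_
    rw [← ENNReal.ofReal_sum_of_nonneg fun j _ => by positivity, ← Finset.mul_sum]
    refine ENNReal.ofReal_le_ofReal ?_
    calc _ ≤ 4 * ε * (w * D) * 2 := by gcongr; exact sum_geometric_two_le k
      _ = _ := by ring
  refine (add_le_add_left hsum _).trans ?_
  simp only [Nat.factorial_zero, Nat.cast_one, inv_one, pow_zero, mul_one, lintegral_const,
    measure_univ]
  rw [show (1 : ℝ≥0∞) = ENNReal.ofReal 1 by simp, ← ENNReal.ofReal_add (by positivity) zero_le_one]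
  exact ENNReal.ofReal_le_ofReal (Real.add_one_le_exp _)

/-- Moments of weighted sums of independent heavy-tailed variables. -/
lemma lintegral_sum_tailWeight_pow_le {n : ℕ} {β A B S : ℝ} (hβ : 1 ≤ β) (hA : 0 ≤ A) (hB : 0 < B)
    {b : Fin n → ℝ} (hb0 : ∀ i, 0 ≤ b i) (hbB : ∀ i, b i ≤ B) (hbS : ∑ i, b i ≤ S)
    {k : ℕ} (hk : k ≠ 0) :
    ∫⁻ x, (∑ i, ENNReal.ofReal (b i) * tailWeight β A (x i)) ^ k ∂(gaussPi n) ≤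
      ENNReal.ofReal (8 * Real.exp 1 * weightRate β *
        ((k : ℝ) ^ β * B + Real.exp (-A ^ 2 / 8) * S)) ^ k := by
  have hβ0 : 0 < β := by linarith
  have hD := weightRate_pos hβ0
  have hm := measurable_tailWeight β A
  have hS0 : 0 ≤ S := (Finset.sum_nonneg fun i _ => hb0 i).trans hbS
  have hk0 : (0 : ℝ) < k := by positivity
  set D := weightRate β
  set ε := Real.exp (-A ^ 2 / 8) with hε
  have hε0 : 0 < ε := Real.exp_pos _
  set R := (k : ℝ) ^ (β - 1) with hR
  have hR0 : 0 < R := by positivity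
  set y : ℝ := 2 * D * R * B + 8 * D * ε * S / k with hy
  have hy0 : 0 < y := by positivity
  have hw : ∀ i, b i / y * D * R ≤ 1 / 2 := by
    intro i
    rw [div_mul_eq_mul_div, div_mul_eq_mul_div, div_le_iff₀ hy0]
    have h1 : b i * D * R ≤ B * D * R := by gcongr; exact hbB i
    have h2 : 0 ≤ 8 * D * ε * S / k := by positivity
    rw [hy]
    linarith
  have hexp : 8 * D * ε * ∑ i, b i / y ≤ k := by
    rw [← Finset.sum_div, mul_div_assoc', div_le_iff₀ hy0]
    calc 8 * D * ε * ∑ i, b i ≤ 8 * D * ε * S := by gcongr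
      _ = k * (8 * D * ε * S / k) := by field_simp
      _ ≤ k * y := by
          gcongr
          rw [hy]
          have : 0 ≤ 2 * D * R * B := by positivity
          linarith
  have hscale : ∀ x : Fin n → ℝ, (∑ i, ENNReal.ofReal (b i) * tailWeight β A (x i)) ^ k =
      ENNReal.ofReal y ^ k * (∑ i, ENNReal.ofReal (b i / y) * tailWeight β A (x i)) ^ k := by
    intro x
    rw [← mul_pow, Finset.mul_sum]
    congr 1
    refine Finset.sum_congr rfl fun i _ => ?_
    rw [← mul_assoc, ← ENNReal.ofReal_mul hy0.le, mul_div_cancel₀ _ hy0.ne']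
  simp_rw [hscale]
  rw [lintegral_const_mul _ (by fun_prop)]
  have hmain : ∫⁻ x, (∑ i, ENNReal.ofReal (b i / y) * tailWeight β A (x i)) ^ k ∂(gaussPi n)
      ≤ k.factorial * ENNReal.ofReal (Real.exp k) := by
    calc _ ≤ ∫⁻ x, k.factorial * ∏ i, truncExp k (ENNReal.ofReal (b i / y) *
          tailWeight β A (x i)) ∂(gaussPi n) :=
          lintegral_mono fun x => sum_pow_le_prod_truncExp _ _ k k le_rfl
      _ = k.factorial * ∏ i, ∫⁻ x, truncExp k (ENNReal.ofReal (b i / y) *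
          tailWeight β A x) ∂(gaussianReal 0 1) := by
          have hmi : ∀ i, Measurable fun x => truncExp k (ENNReal.ofReal (b i / y) *
            tailWeight β A x) := fun i => (measurable_truncExp k).comp (by fun_prop)
          rw [lintegral_const_mul, lintegral_prod_gaussPi hmi]
          exact Finset.measurable_prod _ fun i _ => (hmi i).comp (measurable_pi_apply i)
      _ ≤ k.factorial * ∏ i, ENNReal.ofReal (Real.exp (8 * D * ε * (b i / y))) := by
          gcongr with i
          exact lintegral_truncExp_tailWeight_le hβ hA k (div_nonneg (hb0 i) hy0.le) (hw i)
      _ = k.factorial * ENNReal.ofReal (Real.exp (8 * D * ε * ∑ i, b i / y)) := by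
          rw [← ENNReal.ofReal_prod_of_nonneg fun i _ => (Real.exp_pos _).le, ← Real.exp_sum,
            ← Finset.mul_sum]
      _ ≤ _ := by gcongr
  calc _ ≤ ENNReal.ofReal y ^ k * (k.factorial * ENNReal.ofReal (Real.exp k)) := by gcongr
    _ ≤ ENNReal.ofReal y ^ k * (ENNReal.ofReal k ^ k * ENNReal.ofReal (Real.exp 1) ^ k) := by
        gcongr
        · rw [ENNReal.ofReal_natCast]
          exact_mod_cast Nat.factorial_le_pow k
        · rw [← ENNReal.ofReal_pow (Real.exp_pos _).le, Real.exp_one_pow]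
    _ = ENNReal.ofReal (y * (k * Real.exp 1)) ^ k := by
        rw [← mul_pow, ← mul_pow, ← ENNReal.ofReal_mul hk0.le, ← ENNReal.ofReal_mul hy0.le]
    _ ≤ _ := by
        refine pow_le_pow_left' (ENNReal.ofReal_le_ofReal ?_) k
        have hkβ : (k : ℝ) ^ β = R * k := by
          rw [hR, Real.rpow_sub_one hk0.ne', div_mul_cancel₀ _ hk0.ne']
        have h1 : 0 ≤ Real.exp 1 * D * R * k * B := by positivity
        have h2 : 8 * D * ε * S / k * (k * Real.exp 1) = 8 * D * ε * S * Real.exp 1 := by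
          field_simp
        rw [hkβ, hy, add_mul, h2]
        nlinarith

lemma exists_lipschitzOnWith_of_localLip_lt {α β : Type*} [PseudoMetricSpace α]
    [PseudoMetricSpace β] {g : α → β} {x : α} {c : ℝ≥0∞} (h : localLip g x < c) :
    ∃ K : ℝ≥0, (K : ℝ≥0∞) < c ∧ ∃ s ∈ 𝓝 x, LipschitzOnWith K g s := by
  obtain ⟨_, ⟨ε, hε, rfl⟩, h⟩ := sInf_lt_iff.1 h
  simp only [lipConstOn, iInf_lt_iff] at h
  obtain ⟨K, hK, hlt⟩ := h
  exact ⟨K, hlt, _, Metric.ball_mem_nhds x hε, hK⟩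

lemma locallyLipschitz_of_localLip_lt_top {α β : Type*} [PseudoMetricSpace α]
    [PseudoMetricSpace β] {g : α → β} (h : ∀ x, localLip g x < ∞) : LocallyLipschitz g := fun x => by
  obtain ⟨K, -, hK⟩ := exists_lipschitzOnWith_of_localLip_lt (h x)
  exact ⟨K, hK⟩

lemma abs_deriv_le_of_localLip_le {g : ℝ → ℝ} {x c : ℝ} (hc : 0 ≤ c)
    (h : localLip g x ≤ ENNReal.ofReal c) : |deriv g x| ≤ c := by
  refine le_of_forall_gt fun d hd => ?_
  obtain ⟨K, hK, s, hs, hL⟩ := exists_lipschitzOnWith_of_localLip_lt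
    (h.trans_lt ((ENNReal.ofReal_lt_ofReal_iff (hc.trans_lt hd)).2 hd))
  refine (norm_deriv_le_of_lipschitzOn hs hL).trans_lt ?_
  rw [← ENNReal.ofReal_coe_nnreal] at hK
  exact (ENNReal.ofReal_lt_ofReal_iff (hc.trans_lt hd)).1 hK

lemma lipschitzWith_of_sq_partialDeriv_le {n : ℕ} {f : (Fin n → ℝ) → ℝ} (hf : Differentiable ℝ f)
    {b : Fin n → ℝ} (hb : ∀ i x, partialDeriv f i x ^ 2 ≤ b i) :
    LipschitzWith (∑ i, (√(b i)).toNNReal) f := by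
  refine lipschitzWith_of_nnnorm_fderiv_le hf fun x => ?_
  rw [← NNReal.coe_le_coe, coe_nnnorm]
  push_cast
  refine ContinuousLinearMap.opNorm_le_bound _ (by positivity) fun v => ?_
  rw [fderiv_apply_eq_sum_partialDeriv, Finset.sum_mul]
  refine (norm_sum_le _ _).trans (Finset.sum_le_sum fun i _ => ?_)
  rw [norm_mul, mul_comm, Real.coe_toNNReal _ (Real.sqrt_nonneg _)]
  gcongr
  · exact Real.abs_le_sqrt (hb i x)
  · exact norm_le_pi_norm v i

/-- Tail bound around the median from a moment of the transported gradient. -/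
lemma measure_lt_abs_sub_median_le {n : ℕ} {f : (Fin n → ℝ) → ℝ} (hf : Differentiable ℝ f)
    {K : ℝ≥0} (hK : LipschitzWith K f) {T : Fin n → ℝ → ℝ} (hT : ∀ i, LocallyLipschitz (T i))
    {m : ℝ} (hm : IsMedian (gaussPi n) (fun x => f (fun i => T i (x i))) m)
    {k : ℕ} (hk : k ≠ 0) {V u : ℝ} (hV : 0 ≤ V) (hu : 0 < u)
    (hint : ∫⁻ x, ENNReal.ofReal (∑ i, transportGrad f T x i ^ 2) ^ k ∂(gaussPi n)
      ≤ 2 * ENNReal.ofReal V ^ k)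
    (hVu : 14 * Real.exp 1 * k * V ≤ u ^ 2) :
    gaussPi n {x | u < |f (fun i => T i (x i)) - m|} ≤ ENNReal.ofReal (8 * Real.exp (-k)) := by
  have hFm : Measurable (fun x : Fin n → ℝ => f (fun i => T i (x i))) :=
    hf.continuous.measurable.comp (measurable_pi_lambda _ fun j =>
      (hT j).continuous.measurable.comp (measurable_pi_apply j))
  set F : (Fin n → ℝ) → ℝ := fun x => f (fun i => T i (x i)) with hF
  have hmom := lintegral_enorm_sub_pow_two_mul_le hf hK hT hk
  have hmarkov : ENNReal.ofReal (u ^ (2 * k)) *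
      ((gaussPi n).prod (gaussPi n)) {z | u < |F z.1 - F z.2|} ≤
      2 * ENNReal.ofReal (14 * k) ^ k * (2 * ENNReal.ofReal V ^ k) := by
    refine le_trans ?_ (hmom.trans (mul_le_mul_right hint _))
    refine le_trans ?_ (mul_meas_ge_le_lintegral₀ (Measurable.aemeasurable ?_)
      (ENNReal.ofReal (u ^ (2 * k))))
    · refine mul_le_mul_right (measure_mono fun z hz => ?_) _
      have hz : u < |F z.1 - F z.2| := hz
      change _ ≤ ‖F z.1 - F z.2‖ₑ ^ (2 * k)
      rw [ENNReal.ofReal_pow hu.le, ← ofReal_norm, Real.norm_eq_abs]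
      gcongr
    · exact (((hFm.comp measurable_fst).sub (hFm.comp measurable_snd)).enorm).pow_const _
  have hreal : (14 * k * V) ^ k ≤ Real.exp (-k) * u ^ (2 * k) := by
    have h1 : 14 * k * V ≤ Real.exp (-1) * u ^ 2 := by
      rw [Real.exp_neg, ← div_eq_inv_mul, le_div_iff₀ (Real.exp_pos 1)]
      linarith
    calc (14 * k * V) ^ k ≤ (Real.exp (-1) * u ^ 2) ^ k := by gcongr
      _ = _ := by
          rw [mul_pow, ← pow_mul, ← Real.exp_nat_mul, mul_neg_one]
  have hprod : ((gaussPi n).prod (gaussPi n)) {z | u < |F z.1 - F z.2|}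
      ≤ ENNReal.ofReal (4 * Real.exp (-k)) := by
    have hupos : 0 < u ^ (2 * k) := by positivity
    rw [← ENNReal.mul_le_mul_iff_right (a := ENNReal.ofReal (u ^ (2 * k)))
      (by simpa using hupos) ENNReal.ofReal_ne_top, ← ENNReal.ofReal_mul hupos.le]
    refine hmarkov.trans ?_
    have : 2 * ENNReal.ofReal (14 * k) ^ k * (2 * ENNReal.ofReal V ^ k)
        = ENNReal.ofReal (4 * (14 * k * V) ^ k) := by
      rw [ENNReal.ofReal_mul (p := 4) (by norm_num), ENNReal.ofReal_pow (by positivity),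
        ENNReal.ofReal_mul (p := 14 * k) (by positivity), mul_pow, show ENNReal.ofReal 4 = 2 * 2 by norm_num]
      ring
    rw [this]
    refine ENNReal.ofReal_le_ofReal ?_
    linarith
  refine (hm.measure_lt_abs_sub_le hFm hu.le).trans ?_
  calc _ ≤ 2 * ENNReal.ofReal (4 * Real.exp (-k)) := by gcongr
    _ = _ := by
      rw [show (2 : ℝ≥0∞) = ENNReal.ofReal 2 by simp, ← ENNReal.ofReal_mul (by norm_num)]
      congr 1
      ring

/-- The constant in the moment bounds for weighted sums of `tailWeight`s. -/
noncomputable def weightConst (β : ℝ) : ℝ := 8 * Real.exp 1 * weightRate β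

lemma weightConst_pos {β : ℝ} (hβ : 0 < β) : 0 < weightConst β := by
  have := weightRate_pos hβ
  unfold weightConst; positivity

lemma sq_transportGrad_le {n : ℕ} {f : (Fin n → ℝ) → ℝ} {T : Fin n → ℝ → ℝ} {β : ℝ}
    (hTd : ∀ i s, |deriv (T i) s| ≤ (1 + |s|) ^ β) (x : Fin n → ℝ) (i : Fin n) :
    transportGrad f T x i ^ 2 ≤
      partialDeriv f i (fun j => T j (x j)) ^ 2 * (1 + |x i|) ^ (2 * β) := by
  have h0 : 0 ≤ 1 + |x i| := by positivity
  rw [transportGrad, mul_pow, mul_comm]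
  gcongr
  rw [mul_comm 2 β, Real.rpow_mul h0, Real.rpow_two, ← sq_abs]
  gcongr
  exact hTd i _

lemma median_tail_of_sq_partialDeriv_le {n : ℕ} {f : (Fin n → ℝ) → ℝ} (hf : Differentiable ℝ f)
    {T : Fin n → ℝ → ℝ} {β : ℝ} (hβ : 1 ≤ β) (hT : ∀ i, LocallyLipschitz (T i))
    (hTd : ∀ i s, |deriv (T i) s| ≤ (1 + |s|) ^ β)
    {m : ℝ} (hm : IsMedian (gaussPi n) (fun x => f (fun i => T i (x i))) m)
    {b : Fin n → ℝ} (hb : ∀ i x, partialDeriv f i x ^ 2 ≤ b i) {B S : ℝ} (hB : 0 < B)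
    (hbB : ∀ i, b i ≤ B) (hbS : ∑ i, b i ≤ S) {k : ℕ} (hk : k ≠ 0) {u : ℝ} (hu : 0 < u)
    (hku : 14 * Real.exp 1 * k * (weightConst β * ((k : ℝ) ^ β * B + S)) ≤ u ^ 2) :
    gaussPi n {x | u < |f (fun i => T i (x i)) - m|} ≤ ENNReal.ofReal (8 * Real.exp (-k)) := by
  have hb0 : ∀ i, 0 ≤ b i := fun i => (sq_nonneg _).trans (hb i 0)
  have hS0 : 0 ≤ S := (Finset.sum_nonneg fun i _ => hb0 i).trans hbS
  have hW := weightConst_pos (β := β) (by linarith)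
  refine measure_lt_abs_sub_median_le hf (lipschitzWith_of_sq_partialDeriv_le hf hb) hT hm hk
    (V := weightConst β * ((k : ℝ) ^ β * B + S)) (by positivity) hu ?_ hku
  have h1 := lintegral_sum_tailWeight_pow_le hβ le_rfl hB hb0 hbB hbS hk
  simp only [ne_eq, OfNat.ofNat_ne_zero, not_false_eq_true, zero_pow, neg_zero, zero_div,
    Real.exp_zero, one_mul] at h1
  refine le_trans (lintegral_mono fun x => ?_) (h1.trans ?_)
  · refine pow_le_pow_left' ?_ k
    rw [ENNReal.ofReal_sum_of_nonneg fun i _ => sq_nonneg _]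
    refine Finset.sum_le_sum fun i _ => ?_
    rw [tailWeight, if_pos (abs_nonneg _), ← ENNReal.ofReal_mul (hb0 i)]
    refine ENNReal.ofReal_le_ofReal ((sq_transportGrad_le hTd x i).trans ?_)
    gcongr
    exact hb i _
  · rw [two_mul]
    exact le_self_add

lemma median_tail_of_sum_sq_partialDeriv_le {n : ℕ} {f : (Fin n → ℝ) → ℝ}
    (hf : Differentiable ℝ f) {T : Fin n → ℝ → ℝ} {β : ℝ} (hβ : 1 ≤ β)
    (hT : ∀ i, LocallyLipschitz (T i)) (hTd : ∀ i s, |deriv (T i) s| ≤ (1 + |s|) ^ β)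
    {m : ℝ} (hm : IsMedian (gaussPi n) (fun x => f (fun i => T i (x i))) m)
    {B S : ℝ} (hB : 0 < B) (hb : ∀ i x, partialDeriv f i x ^ 2 ≤ B)
    (hS : ∀ x, ∑ i, partialDeriv f i x ^ 2 ≤ S) {k : ℕ} (hk : k ≠ 0) {u : ℝ} (hu : 0 < u)
    {A : ℝ} (hA : 0 ≤ A)
    (hku : 14 * Real.exp 1 * k * (2 * ((1 + A) ^ (2 * β) * S +
      weightConst β * ((k : ℝ) ^ β * B + Real.exp (-A ^ 2 / 8) * (n * B)))) ≤ u ^ 2) :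
    gaussPi n {x | u < |f (fun i => T i (x i)) - m|} ≤ ENNReal.ofReal (8 * Real.exp (-k)) := by
  have hS0 : 0 ≤ S := (Finset.sum_nonneg fun i _ => sq_nonneg _).trans (hS 0)
  have hW := weightConst_pos (β := β) (by linarith)
  set p : ℝ := (1 + A) ^ (2 * β) * S with hp
  have hp0 : 0 ≤ p := by positivity
  set r : ℝ := weightConst β * ((k : ℝ) ^ β * B + Real.exp (-A ^ 2 / 8) * (n * B)) with hr
  have hr0 : 0 ≤ r := by positivity
  refine measure_lt_abs_sub_median_le hf (lipschitzWith_of_sq_partialDeriv_le hf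
    (b := fun _ => B) hb) hT hm hk (V := 2 * (p + r)) (by positivity) hu ?_ hku
  have h1 := lintegral_sum_tailWeight_pow_le (n := n) (S := n * B) hβ hA hB (b := fun _ => B)
    (fun _ => hB.le) (fun _ => le_rfl) (by simp) hk
  have hpt : ∀ x, ENNReal.ofReal (∑ i, transportGrad f T x i ^ 2) ≤
      ENNReal.ofReal p + ∑ i, ENNReal.ofReal B * tailWeight β A (x i) := by
    intro x
    have hstep : ∀ i, ENNReal.ofReal (transportGrad f T x i ^ 2) ≤
        ENNReal.ofReal ((1 + A) ^ (2 * β) * partialDeriv f i (fun j => T j (x j)) ^ 2) +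
          ENNReal.ofReal B * tailWeight β A (x i) := by
      intro i
      rw [tailWeight]
      split_ifs with h
      · refine le_add_left ?_
        rw [← ENNReal.ofReal_mul hB.le]
        refine ENNReal.ofReal_le_ofReal ((sq_transportGrad_le hTd x i).trans ?_)
        gcongr
        exact hb i _
      · rw [mul_zero, add_zero]
        refine ENNReal.ofReal_le_ofReal ((sq_transportGrad_le hTd x i).trans ?_)
        rw [mul_comm]
        gcongr
        exact (not_le.1 h).le
    calc _ = ∑ i, ENNReal.ofReal (transportGrad f T x i ^ 2) :=
          ENNReal.ofReal_sum_of_nonneg fun i _ => sq_nonneg _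
      _ ≤ _ := Finset.sum_le_sum fun i _ => hstep i
      _ ≤ _ := by
          rw [Finset.sum_add_distrib, ← ENNReal.ofReal_sum_of_nonneg fun i _ => by positivity,
            ← Finset.mul_sum]
          gcongr
          rw [hp]
          gcongr
          exact hS _
  have hadd : ∀ a b : ℝ≥0∞, (a + b) ^ k ≤ 2 ^ k * (a ^ k + b ^ k) := fun a b => by
    rcases le_total a b with h | h
    · calc (a + b) ^ k ≤ (2 * b) ^ k := by rw [two_mul]; gcongr
        _ = 2 ^ k * b ^ k := mul_pow _ _ _
        _ ≤ _ := by gcongr; exact le_add_self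
    · calc (a + b) ^ k ≤ (2 * a) ^ k := by rw [two_mul]; gcongr
        _ = 2 ^ k * a ^ k := mul_pow _ _ _
        _ ≤ _ := by gcongr; exact le_self_add
  have htw := measurable_tailWeight β A
  calc _ ≤ ∫⁻ x, 2 ^ k * (ENNReal.ofReal p ^ k +
        (∑ i, ENNReal.ofReal B * tailWeight β A (x i)) ^ k) ∂(gaussPi n) :=
        lintegral_mono fun x => (pow_le_pow_left' (hpt x) k).trans (hadd _ _)
    _ = 2 ^ k * (ENNReal.ofReal p ^ k +
        ∫⁻ x, (∑ i, ENNReal.ofReal B * tailWeight β A (x i)) ^ k ∂(gaussPi n)) := by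
        rw [lintegral_const_mul _ (by fun_prop), lintegral_add_left measurable_const,
          lintegral_const, measure_univ, mul_one]
    _ ≤ 2 ^ k * (ENNReal.ofReal (p + r) ^ k + ENNReal.ofReal (p + r) ^ k) := by
        gcongr
        · linarith
        · refine h1.trans ?_
          refine pow_le_pow_left' (ENNReal.ofReal_le_ofReal ?_) k
          change r ≤ p + r
          linarith
    _ = _ := by
        rw [ENNReal.ofReal_mul (by norm_num), mul_pow]
        simp only [ENNReal.ofReal_ofNat]
        ring

lemma median_tail_eq_zero_of_partialDeriv_eq_zero {n : ℕ} {f : (Fin n → ℝ) → ℝ}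
    (hf : Differentiable ℝ f) (h0 : ∀ i x, partialDeriv f i x = 0) {T : Fin n → ℝ → ℝ} {m : ℝ}
    (hm : IsMedian (gaussPi n) (fun x => f (fun i => T i (x i))) m) {u : ℝ} (hu : 0 ≤ u) :
    gaussPi n {x | u < |f (fun i => T i (x i)) - m|} = 0 := by
  have hconst : ∀ x y, f x = f y := is_const_of_fderiv_eq_zero hf fun x => by
    ext v
    simp [fderiv_apply_eq_sum_partialDeriv, h0]
  have hFm : Measurable (fun x : Fin n → ℝ => f (fun i => T i (x i))) := by
    have : (fun x : Fin n → ℝ => f (fun i => T i (x i))) = fun _ => f 0 :=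
      funext fun x => hconst _ _
    rw [this]; exact measurable_const
  refine le_antisymm ((hm.measure_lt_abs_sub_le hFm hu).trans ?_) zero_le
  have : {z : (Fin n → ℝ) × (Fin n → ℝ) |
      u < |f (fun i => T i (z.1 i)) - f (fun i => T i (z.2 i))|} = ∅ := by
    ext z
    simp [hconst (fun i => T i (z.1 i)) (fun i => T i (z.2 i)), hu]
  simp [this]

lemma sq_le_toReal_of_enorm_rpow_le {a : ℝ} {b : ℝ≥0∞} (hb : b ≠ ∞) (h : ‖a‖ₑ ^ (2 : ℝ) ≤ b) :
    a ^ 2 ≤ b.toReal := by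
  rw [ENNReal.rpow_two, ← ofReal_norm, ← ENNReal.ofReal_pow (norm_nonneg _),
    ENNReal.ofReal_le_iff_le_toReal hb] at h
  simpa using h

section Lip

variable {n : ℕ} {f : (Fin n → ℝ) → ℝ}

lemma lipSharp_top_eq : lipSharp ∞ f = ⨆ i : Fin n, ⨆ x, ‖partialDeriv f i x‖ₑ := by
  simp [lipSharp]

lemma lipGrad_top_eq : lipGrad ∞ f = ⨆ x, ⨆ i : Fin n, ‖partialDeriv f i x‖ₑ := by
  simp [lipGrad]

lemma lipSharp_two_sq :
    lipSharp 2 f ^ (2 : ℝ) = ∑ i : Fin n, ⨆ x, ‖partialDeriv f i x‖ₑ ^ (2 : ℝ) := by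
  simp only [lipSharp, ENNReal.ofNat_ne_top, if_false, ENNReal.toReal_ofNat]
  rw [← ENNReal.rpow_mul]
  norm_num

lemma sum_rpow_le_lipGrad_two_sq (x : Fin n → ℝ) :
    ∑ i : Fin n, ‖partialDeriv f i x‖ₑ ^ (2 : ℝ) ≤ lipGrad 2 f ^ (2 : ℝ) := by
  simp only [lipGrad, ENNReal.ofNat_ne_top, if_false, ENNReal.toReal_ofNat]
  refine le_trans (le_of_eq ?_) (ENNReal.rpow_le_rpow (le_iSup _ x) (by norm_num))
  rw [← ENNReal.rpow_mul]
  norm_num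

lemma enorm_partialDeriv_le_lipSharp_top (i : Fin n) (x : Fin n → ℝ) :
    ‖partialDeriv f i x‖ₑ ≤ lipSharp ∞ f := by
  rw [lipSharp_top_eq]
  exact le_iSup_of_le i (le_iSup (fun x => ‖partialDeriv f i x‖ₑ) x)

lemma enorm_partialDeriv_le_lipGrad_top (i : Fin n) (x : Fin n → ℝ) :
    ‖partialDeriv f i x‖ₑ ≤ lipGrad ∞ f := by
  rw [lipGrad_top_eq]
  exact le_iSup_of_le x (le_iSup (fun i => ‖partialDeriv f i x‖ₑ) i)

lemma partialDeriv_eq_zero_of_lipSharp_two (h : lipSharp 2 f = 0) (i : Fin n) (x : Fin n → ℝ) :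
    partialDeriv f i x = 0 := by
  have h1 := lipSharp_two_sq (f := f)
  rw [h, ENNReal.zero_rpow_of_pos (by norm_num)] at h1
  have h2 := (Finset.sum_eq_zero_iff.1 h1.symm) i (Finset.mem_univ i)
  have h3 := ENNReal.iSup_eq_zero.1 h2 x
  simpa using h3

end Lip

/-- The law of independent random variables is a coordinatewise transport of the standard Gaussian
measure. -/
lemma map_eq_map_gaussPi {n : ℕ} {μ : Fin n → Measure ℝ} [∀ i, IsProbabilityMeasure (μ i)]
    {Ω : Type*} [MeasurableSpace Ω] {P : Measure Ω} [IsProbabilityMeasure P] {X : Fin n → Ω → ℝ}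
    (hX : ∀ i, HasLaw (X i) (μ i) P) (hind : iIndepFun X P) :
    P.map (fun ω i => X i ω) =
      (gaussPi n).map (fun x i => quantile (μ i) (stdNormalCDF (x i))) := by
  have hmap : ∀ i, (gaussianReal 0 1).map (fun x => quantile (μ i) (stdNormalCDF x)) = μ i :=
    fun i => map_quantile_stdNormalCDF (μ i)
  rw [(iIndepFun_iff_map_fun_eq_pi_map fun i => (hX i).aemeasurable).1 hind]
  have hs : ∀ i, SigmaFinite ((gaussianReal 0 1).map
      (fun x => quantile (μ i) (stdNormalCDF x))) := fun i => by rw [hmap i]; infer_instance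
  rw [gaussPi, Measure.pi_map_pi (f := fun i x => quantile (μ i) (stdNormalCDF x))
    fun i => (measurable_quantile_stdNormalCDF (μ i)).aemeasurable]
  congr 1
  ext1 i
  rw [hmap i, (hX i).map_eq]

/-- The exponent scale of the first concentration bound. -/
noncomputable def expRate (β : ℝ) : ℝ := 1 / (1 + 28 * Real.exp 1 * weightConst β)

lemma expRate_pos {β : ℝ} (hβ : 0 < β) : 0 < expRate β := by
  have := weightConst_pos hβ
  unfold expRate; positivity

lemma median_tail_lipSharp {q : ℝ} (hq0 : 0 < q) (hq1 : q < 1) {n : ℕ} {f : (Fin n → ℝ) → ℝ}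
    (hf : Differentiable ℝ f) {T : Fin n → ℝ → ℝ} (hT : ∀ i, LocallyLipschitz (T i))
    (hTd : ∀ i s, |deriv (T i) s| ≤ (1 + |s|) ^ (-1 + 2 / q))
    {m : ℝ} (hm : IsMedian (gaussPi n) (fun x => f (fun i => T i (x i))) m)
    {b : Fin n → ℝ} (hb : ∀ i x, partialDeriv f i x ^ 2 ≤ b i) {L₂ L : ℝ} (hL₂ : 0 < L₂)
    (hL : 0 < L) (hbL : ∀ i, b i ≤ L ^ 2) (hbS : ∑ i, b i ≤ L₂ ^ 2) {t : ℝ} (ht : 0 < t) :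
    gaussPi n {x | t < |f (fun i => T i (x i)) - m|} ≤ ENNReal.ofReal
      (2 * Real.exp (-(expRate (-1 + 2 / q) / 5 * min ((t / L₂) ^ 2) ((t / L) ^ q)))) := by
  set β := -1 + 2 / q with hβ
  have hβ1 : 1 ≤ β := by
    have : 2 ≤ 2 / q := by rw [le_div_iff₀ hq0]; linarith
    linarith
  have hβ0 : 0 < β := by linarith
  have hqβ : q * (β + 1) = 2 := by rw [hβ]; field_simp; ring
  have hW := weightConst_pos hβ0
  have hc := expRate_pos hβ0
  set W := weightConst β
  set c := expRate β with hcdef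
  set M := min ((t / L₂) ^ 2) ((t / L) ^ q) with hM
  have hM0 : 0 < M := by positivity
  have hc1 : c ≤ 1 := by
    rw [hcdef, expRate, div_le_one (by positivity)]
    have : 0 ≤ 28 * Real.exp 1 * W := by positivity
    linarith
  have hcW : 28 * Real.exp 1 * W * c ≤ 1 := by
    rw [hcdef, expRate, mul_one_div, div_le_one (by positivity)]
    linarith
  by_cases hsmall : c / 5 * M ≤ Real.log 2
  · refine prob_le_one.trans ?_
    rw [← ENNReal.ofReal_one]
    refine ENNReal.ofReal_le_ofReal ?_
    have h1 : Real.exp (-Real.log 2) ≤ Real.exp (-(c / 5 * M)) := by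
      rw [Real.exp_le_exp]; linarith
    rw [Real.exp_neg, Real.exp_log two_pos] at h1
    linarith
  rw [not_le] at hsmall
  have hlog := Real.log_two_gt_d9
  have hlog' := Real.log_two_lt_d9
  set k := ⌊c * M⌋₊ with hk
  have hkM : (k : ℝ) ≤ c * M := Nat.floor_le (by positivity)
  have hk1 : c * M < k + 1 := Nat.lt_floor_add_one _
  have hk0 : k ≠ 0 := by
    have : 1 ≤ k := Nat.le_floor (by push_cast; linarith)
    omega
  have hkpos : (0 : ℝ) < k := by positivity
  have hkS : (k : ℝ) * L₂ ^ 2 ≤ c * t ^ 2 := by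
    calc (k : ℝ) * L₂ ^ 2 ≤ c * (t / L₂) ^ 2 * L₂ ^ 2 := by
          gcongr
          exact hkM.trans (by gcongr; exact min_le_left _ _)
      _ = c * t ^ 2 := by field_simp
  have hkB : (k : ℝ) * ((k : ℝ) ^ β * L ^ 2) ≤ c * t ^ 2 := by
    have h1 : (k : ℝ) ≤ c * (t / L) ^ q := hkM.trans (by gcongr; exact min_le_right _ _)
    calc (k : ℝ) * ((k : ℝ) ^ β * L ^ 2) = (k : ℝ) ^ (β + 1) * L ^ 2 := by
          rw [Real.rpow_add_one hkpos.ne']; ring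
      _ ≤ (c * (t / L) ^ q) ^ (β + 1) * L ^ 2 := by gcongr
      _ = c ^ (β + 1) * (t / L) ^ 2 * L ^ 2 := by
          rw [Real.mul_rpow hc.le (by positivity), ← Real.rpow_mul (by positivity), hqβ,
            Real.rpow_two]
      _ ≤ c * (t / L) ^ 2 * L ^ 2 := by
          gcongr
          calc c ^ (β + 1) ≤ c ^ (1 : ℝ) :=
                Real.rpow_le_rpow_of_exponent_ge hc hc1 (by linarith)
            _ = c := Real.rpow_one c
      _ = c * t ^ 2 := by field_simp
  have htail := median_tail_of_sq_partialDeriv_le hf hβ1 hT hTd hm hb (B := L ^ 2) (S := L₂ ^ 2)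
    (by positivity) hbL hbS hk0 ht (by
      calc _ = 14 * Real.exp 1 * W * ((k : ℝ) * ((k : ℝ) ^ β * L ^ 2) + k * L₂ ^ 2) := by ring
        _ ≤ 14 * Real.exp 1 * W * (c * t ^ 2 + c * t ^ 2) := by gcongr
        _ = (28 * Real.exp 1 * W * c) * t ^ 2 := by ring
        _ ≤ 1 * t ^ 2 := by gcongr
        _ = t ^ 2 := one_mul _)
  refine htail.trans (ENNReal.ofReal_le_ofReal ?_)
  have h8 : (8 : ℝ) = 2 * Real.exp (2 * Real.log 2) := by
    rw [two_mul (Real.log 2), Real.exp_add, Real.exp_log two_pos]; norm_num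
  rw [h8, mul_assoc, ← Real.exp_add]
  gcongr
  linarith

lemma median_tail_lipGrad {q : ℝ} (hq0 : 0 < q) (hq1 : q < 1) {n : ℕ} {f : (Fin n → ℝ) → ℝ}
    (hf : Differentiable ℝ f) {T : Fin n → ℝ → ℝ} (hT : ∀ i, LocallyLipschitz (T i))
    (hTd : ∀ i s, |deriv (T i) s| ≤ (1 + |s|) ^ (-1 + 2 / q))
    {m : ℝ} (hm : IsMedian (gaussPi n) (fun x => f (fun i => T i (x i))) m)
    {L₂ L : ℝ} (hL₂ : 0 ≤ L₂) (hL : 0 < L) (hb : ∀ i x, partialDeriv f i x ^ 2 ≤ L ^ 2)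
    (hS : ∀ x, ∑ i, partialDeriv f i x ^ 2 ≤ L₂ ^ 2) {t : ℝ} (ht : 0 < t)
    (ht2 : 2 * Real.log 2 < t ^ 2) {C : ℝ} (hC : 0 < C)
    (hC2 : 84 * Real.exp 1 * (16 ^ (-1 + 2 / q) +
      2 * weightConst (-1 + 2 / q) * 3 ^ (-1 + 2 / q)) ≤ C ^ 2) :
    gaussPi n {x | C * Real.log (Real.exp 1 + n / t ^ (-2 + 4 / q)) ^ (1 / q - 1 / 2) *
      (t * L₂ + t ^ (2 / q) * L) < |f (fun i => T i (x i)) - m|} ≤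
      ENNReal.ofReal (2 * Real.exp (-t ^ 2 / 2)) := by
  set β := -1 + 2 / q with hβ
  have hβ1 : 1 ≤ β := by
    have : 2 ≤ 2 / q := by rw [le_div_iff₀ hq0]; linarith
    linarith
  have hβ0 : 0 < β := by linarith
  have hW := weightConst_pos hβ0
  set W := weightConst β
  have e1 : -2 + 4 / q = 2 * β := by rw [hβ]; ring
  have e2 : 1 / q - 1 / 2 = β / 2 := by rw [hβ]; ring
  have e3 : 2 / q = β + 1 := by rw [hβ]; ring
  rw [e1, e2, e3]
  have htβ : 0 < t ^ (2 * β) := by positivity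
  set N := Real.exp 1 + n / t ^ (2 * β) with hN
  have hN0 : Real.exp 1 ≤ N := by
    have : 0 ≤ n / t ^ (2 * β) := by positivity
    linarith
  have hNpos : 0 < N := (Real.exp_pos 1).trans_le hN0
  set l := Real.log N with hl
  have hl1 : 1 ≤ l := by
    rw [hl, Real.le_log_iff_exp_le hNpos]; exact hN0
  have hl0 : 0 < l := by linarith
  have hlog := Real.log_two_gt_d9
  set k := ⌈2 * t ^ 2⌉₊ with hk
  have hkl : 2 * t ^ 2 ≤ k := Nat.le_ceil _
  have hkr : (k : ℝ) ≤ 3 * t ^ 2 := by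
    have := Nat.ceil_lt_add_one (show 0 ≤ 2 * t ^ 2 by positivity)
    linarith
  have hkpos : (0 : ℝ) < k := by
    have : 0 < t ^ 2 := by positivity
    linarith
  have hk0 : k ≠ 0 := by
    rintro h
    rw [h] at hkpos
    simp at hkpos
  set A := √(8 * l) with hA
  have hA2 : A ^ 2 = 8 * l := Real.sq_sqrt (by positivity)
  have hA0 : 0 ≤ A := Real.sqrt_nonneg _
  have hkβ : (k : ℝ) ^ β ≤ 3 ^ β * t ^ (2 * β) := by
    calc (k : ℝ) ^ β ≤ (3 * t ^ 2) ^ β := by gcongr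
      _ = _ := by
          rw [Real.mul_rpow (by norm_num) (by positivity), Real.rpow_mul ht.le, Real.rpow_two]
  have hεn : Real.exp (-A ^ 2 / 8) * n ≤ 3 ^ β * t ^ (2 * β) := by
    have h1 : Real.exp (-A ^ 2 / 8) = N⁻¹ := by
      rw [show -A ^ 2 / 8 = -l by rw [hA2]; ring, Real.exp_neg, hl,
        Real.exp_log hNpos]
    have h2 : (n : ℝ) ≤ N * t ^ (2 * β) := by
      rw [hN, add_mul, div_mul_cancel₀ _ htβ.ne']
      have : 0 ≤ Real.exp 1 * t ^ (2 * β) := by positivity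
      linarith
    have h3 : (1 : ℝ) ≤ 3 ^ β := Real.one_le_rpow (by norm_num) hβ0.le
    calc _ = n / N := by rw [h1]; field_simp
      _ ≤ 1 * t ^ (2 * β) := by rw [div_le_iff₀ hNpos]; linarith
      _ ≤ _ := by gcongr
  have hAβ : (1 + A) ^ (2 * β) ≤ 16 ^ β * l ^ β := by
    have h1 : (1 + A) ^ 2 ≤ 16 * l := by
      have h2 : A ≤ (A ^ 2 + 8) / 4 := by nlinarith [sq_nonneg (A - 2)]
      nlinarith
    rw [Real.rpow_mul (by positivity), Real.rpow_two, ← Real.mul_rpow (by norm_num) hl0.le]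
    gcongr
  set Q := C * l ^ (β / 2) * (t * L₂ + t ^ (β + 1) * L) with hQ
  have hlβ : (l ^ (β / 2)) ^ 2 = l ^ β := by
    rw [← Real.rpow_two, ← Real.rpow_mul hl0.le]
    congr 1
    ring
  have hlβ1 : 1 ≤ l ^ β := Real.one_le_rpow hl1 hβ0.le
  have hQ2 : C ^ 2 * l ^ β * (t ^ 2 * L₂ ^ 2 + t ^ 2 * t ^ (2 * β) * L ^ 2) ≤ Q ^ 2 := by
    have h1 : (t ^ (β + 1)) ^ 2 = t ^ 2 * t ^ (2 * β) := by
      rw [← Real.rpow_two, ← Real.rpow_two, ← Real.rpow_mul ht.le, ← Real.rpow_add ht]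
      congr 1
      ring
    rw [hQ, mul_pow, mul_pow, hlβ]
    gcongr
    have h2 : 0 ≤ t * L₂ * (t ^ (β + 1) * L) := by positivity
    calc _ = (t * L₂) ^ 2 + (t ^ (β + 1) * L) ^ 2 := by rw [mul_pow, mul_pow, h1]
      _ ≤ _ := by nlinarith
  have htail := median_tail_of_sum_sq_partialDeriv_le hf hβ1 hT hTd hm (B := L ^ 2) (S := L₂ ^ 2)
    (by positivity) hb hS hk0 (u := Q) (by positivity) hA0 (by
      refine le_trans ?_ hQ2
      calc _ ≤ 14 * Real.exp 1 * (3 * t ^ 2) * (2 * (16 ^ β * l ^ β * L₂ ^ 2 +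
            W * (3 ^ β * t ^ (2 * β) * L ^ 2 + 3 ^ β * t ^ (2 * β) * L ^ 2))) := by
            rw [← mul_assoc (Real.exp (-A ^ 2 / 8))]
            gcongr
        _ = 84 * Real.exp 1 * (16 ^ β) * (l ^ β * (t ^ 2 * L₂ ^ 2)) +
            84 * Real.exp 1 * (2 * W * 3 ^ β) * (1 * (t ^ 2 * t ^ (2 * β) * L ^ 2)) := by ring
        _ ≤ C ^ 2 * (l ^ β * (t ^ 2 * L₂ ^ 2)) +
            C ^ 2 * (l ^ β * (t ^ 2 * t ^ (2 * β) * L ^ 2)) := by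
            have h16 : 0 ≤ 84 * Real.exp 1 * (16 : ℝ) ^ β := by positivity
            have h3 : 0 ≤ 84 * Real.exp 1 * (2 * W * 3 ^ β) := by positivity
            gcongr
            · linarith
            · linarith
        _ = _ := by ring)
  refine htail.trans (ENNReal.ofReal_le_ofReal ?_)
  have h8 : (8 : ℝ) = 2 * Real.exp (2 * Real.log 2) := by
    rw [two_mul (Real.log 2), Real.exp_add, Real.exp_log two_pos]; norm_num
  rw [h8, mul_assoc, ← Real.exp_add]
  gcongr
  linarith

/-- Concentration about the median for Weibull type tails, `0 < q < 1`. The constants `c`, `C`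
depend only on `q`. The quotients `t / Lip` are taken in `[0, ∞]`, with `t / 0 = ∞`, `t / ∞ = 0`
and `exp (-∞) = 0`. -/
theorem stmt_17 (q : ℝ) (hq0 : 0 < q) (hq1 : q < 1) :
    ∃ c C : ℝ, 0 < c ∧ 0 < C ∧
      ∀ (n : ℕ) (μ : Fin n → Measure ℝ), (∀ i, IsProbabilityMeasure (μ i)) →
      (∀ (i : Fin n) (s : ℝ),
        localLip (fun x => quantile (μ i) (stdNormalCDF x)) s
          ≤ ENNReal.ofReal ((1 + |s|) ^ (-1 + 2 / q))) →
      ∀ (f : (Fin n → ℝ) → ℝ), Differentiable ℝ f →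
      ∀ (Ω : Type*) [MeasurableSpace Ω] (P : Measure Ω) [IsProbabilityMeasure P]
        (X : Fin n → Ω → ℝ), (∀ i, HasLaw (X i) (μ i) P) → iIndepFun X P →
      ∀ m : ℝ, IsMedian P (fun ω => f (fun i => X i ω)) m →
      ∀ t : ℝ, 0 < t →
        P {ω | t < |f (fun i => X i ω) - m|} ≤
          2 * EReal.exp (-((ENNReal.ofReal c *
            min ((ENNReal.ofReal t / lipSharp 2 f) ^ 2)
              ((ENNReal.ofReal t / lipSharp ∞ f) ^ q) : ℝ≥0∞) : EReal)) ∧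
        P {ω | ENNReal.ofReal (C * Real.log (Real.exp 1 + n / t ^ (-2 + 4 / q)) ^ (1 / q - 1 / 2)) *
              (ENNReal.ofReal t * lipGrad 2 f + ENNReal.ofReal (t ^ (2 / q)) * lipGrad ∞ f)
            < ENNReal.ofReal |f (fun i => X i ω) - m|} ≤
          ENNReal.ofReal (2 * Real.exp (-t ^ 2 / 2)) := by
  set β := -1 + 2 / q with hβ
  have hβ0 : 0 < β := by
    have : 2 ≤ 2 / q := by rw [le_div_iff₀ hq0]; linarith
    linarith
  have hW := weightConst_pos hβ0
  set C := √(84 * Real.exp 1 * (16 ^ β + 2 * weightConst β * 3 ^ β)) with hCdef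
  have hC : 0 < C := by positivity
  have hC2 : 84 * Real.exp 1 * (16 ^ β + 2 * weightConst β * 3 ^ β) ≤ C ^ 2 :=
    (Real.sq_sqrt (by positivity)).ge
  refine ⟨expRate β / 5, C, div_pos (expRate_pos hβ0) (by norm_num), hC, ?_⟩
  intro n μ hμ hlip f hf Ω _ P _ X hX hind m hm t ht
  set T : Fin n → ℝ → ℝ := fun i x => quantile (μ i) (stdNormalCDF x) with hTdef
  have hT : ∀ i, LocallyLipschitz (T i) := fun i =>
    locallyLipschitz_of_localLip_lt_top fun s => (hlip i s).trans_lt ENNReal.ofReal_lt_top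
  have hTd : ∀ i s, |deriv (T i) s| ≤ (1 + |s|) ^ β := fun i s =>
    abs_deriv_le_of_localLip_le (by positivity) (hlip i s)
  have hfm : Measurable f := hf.continuous.measurable
  have hTm : Measurable (fun (x : Fin n → ℝ) i => T i (x i)) := measurable_pi_lambda _ fun j =>
    (hT j).continuous.measurable.comp (measurable_pi_apply j)
  have htransfer : ∀ E : Set ℝ, MeasurableSet E →
      P {ω | f (fun i => X i ω) ∈ E} = gaussPi n {x | f (fun i => T i (x i)) ∈ E} := by
    intro E hE
    have hXm : AEMeasurable (fun ω i => X i ω) P :=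
      aemeasurable_pi_lambda _ fun i => (hX i).aemeasurable
    have h := congrArg (fun ν => ν (f ⁻¹' E)) (map_eq_map_gaussPi hX hind)
    rwa [Measure.map_apply_of_aemeasurable hXm (hfm hE), Measure.map_apply hTm (hfm hE)] at h
  have hm' : IsMedian (gaussPi n) (fun x => f (fun i => T i (x i))) m :=
    ⟨hm.1.trans_eq (htransfer (Set.Iic m) measurableSet_Iic),
      hm.2.trans_eq (htransfer (Set.Ici m) measurableSet_Ici)⟩
  have htail : ∀ u : ℝ, P {ω | u < |f (fun i => X i ω) - m|} =
      gaussPi n {x | u < |f (fun i => T i (x i)) - m|} := fun u =>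
    htransfer {y | u < |y - m|} (measurableSet_lt measurable_const (by fun_prop))
  constructor
  · by_cases hzero : lipSharp 2 f = 0 ∨ lipSharp ∞ f = 0
    · have h0 : ∀ i x, partialDeriv f i x = 0 := by
        rcases hzero with h | h
        · exact partialDeriv_eq_zero_of_lipSharp_two h
        · intro i x
          have := enorm_partialDeriv_le_lipSharp_top (f := f) i x
          rw [h] at this
          simpa using this
      rw [htail, median_tail_eq_zero_of_partialDeriv_eq_zero hf h0 hm' ht.le]
      exact zero_le
    push Not at hzero
    by_cases htop : lipSharp 2 f = ∞ ∨ lipSharp ∞ f = ∞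
    · have hmin : min ((ENNReal.ofReal t / lipSharp 2 f) ^ 2)
          ((ENNReal.ofReal t / lipSharp ∞ f) ^ q) = 0 := by
        rcases htop with h | h
        · rw [h]; simp
        · rw [h]; simp [hq0]
      rw [hmin]
      simp only [mul_zero, EReal.coe_ennreal_zero, neg_zero, EReal.exp_zero, mul_one]
      exact prob_le_one.trans one_le_two
    push Not at htop
    set L₂ := (lipSharp 2 f).toReal with hL₂
    set L := (lipSharp ∞ f).toReal with hL
    have hL₂0 : 0 < L₂ := ENNReal.toReal_pos hzero.1 htop.1
    have hL0 : 0 < L := ENNReal.toReal_pos hzero.2 htop.2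
    have eL₂ : lipSharp 2 f = ENNReal.ofReal L₂ := (ENNReal.ofReal_toReal htop.1).symm
    have eL : lipSharp ∞ f = ENNReal.ofReal L := (ENNReal.ofReal_toReal htop.2).symm
    set b : Fin n → ℝ≥0∞ := fun i => ⨆ x, ‖partialDeriv f i x‖ₑ ^ (2 : ℝ) with hb
    have hbL : ∀ i, b i ≤ ENNReal.ofReal (L ^ 2) := by
      intro i
      refine iSup_le fun x => ?_
      rw [ENNReal.ofReal_pow hL0.le, ← eL, ENNReal.rpow_two]
      gcongr
      exact enorm_partialDeriv_le_lipSharp_top i x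
    have hbtop : ∀ i, b i ≠ ∞ := fun i => ((hbL i).trans_lt ENNReal.ofReal_lt_top).ne
    have hbS : ∑ i, (b i).toReal ≤ L₂ ^ 2 := by
      rw [← ENNReal.toReal_sum fun i _ => hbtop i, hb, ← lipSharp_two_sq, ENNReal.rpow_two,
        ENNReal.toReal_pow]
    have hmain := median_tail_lipSharp hq0 hq1 hf hT hTd hm' (b := fun i => (b i).toReal)
      (fun i x => sq_le_toReal_of_enorm_rpow_le (hbtop i)
        (le_iSup (fun x => ‖partialDeriv f i x‖ₑ ^ (2 : ℝ)) x))
      hL₂0 hL0 (fun i => ENNReal.toReal_le_of_le_ofReal (by positivity) (hbL i)) hbS ht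
    rw [htail]
    refine hmain.trans (le_of_eq ?_)
    have hc := expRate_pos hβ0
    rw [eL₂, eL, ← ENNReal.ofReal_div_of_pos hL₂0, ← ENNReal.ofReal_div_of_pos hL0,
      ← ENNReal.ofReal_pow (by positivity), ENNReal.ofReal_rpow_of_nonneg (by positivity) hq0.le,
      ← ENNReal.ofReal_min, ← ENNReal.ofReal_mul (by positivity), EReal.coe_ennreal_ofReal,
      max_eq_left (by positivity), ← EReal.coe_neg, EReal.exp_coe, ENNReal.ofReal_mul (by norm_num),
      ENNReal.ofReal_ofNat]
  · by_cases ht2 : t ^ 2 ≤ 2 * Real.log 2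
    · refine prob_le_one.trans ?_
      rw [← ENNReal.ofReal_one]
      refine ENNReal.ofReal_le_ofReal ?_
      have h1 : Real.exp (-Real.log 2) ≤ Real.exp (-t ^ 2 / 2) := by
        rw [Real.exp_le_exp]; linarith
      rw [Real.exp_neg, Real.exp_log two_pos] at h1
      linarith
    rw [not_le] at ht2
    have hlog : 0 < Real.log (Real.exp 1 + n / t ^ (-2 + 4 / q)) := by
      refine Real.log_pos ?_
      have h1 : 0 ≤ n / t ^ (-2 + 4 / q) := by positivity
      have h2 := Real.one_lt_exp_iff.2 one_pos
      linarith
    have hfac : 0 < C * Real.log (Real.exp 1 + n / t ^ (-2 + 4 / q)) ^ (1 / q - 1 / 2) := by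
      positivity
    by_cases htop : lipGrad 2 f = ∞ ∨ lipGrad ∞ f = ∞
    · have hthr : ENNReal.ofReal t * lipGrad 2 f + ENNReal.ofReal (t ^ (2 / q)) * lipGrad ∞ f
          = ∞ := by
        rcases htop with h | h
        · rw [h, ENNReal.mul_top (by simpa using ht), top_add]
        · have : 0 < t ^ (2 / q) := by positivity
          rw [h, ENNReal.mul_top (by simpa using this), add_top]
      rw [hthr, ENNReal.mul_top (by simpa using hfac)]
      simp
    push Not at htop
    by_cases hzero : lipGrad ∞ f = 0
    · have h0 : ∀ i x, partialDeriv f i x = 0 := by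
        intro i x
        have := enorm_partialDeriv_le_lipGrad_top (f := f) i x
        rw [hzero] at this
        simpa using this
      have h1 : P {ω | 0 < |f (fun i => X i ω) - m|} = 0 := by
        rw [htail, median_tail_eq_zero_of_partialDeriv_eq_zero hf h0 hm' le_rfl]
      refine (measure_mono fun ω hω => ?_).trans (h1.le.trans zero_le)
      exact ENNReal.ofReal_pos.1 (bot_le.trans_lt hω)
    set L₂ := (lipGrad 2 f).toReal with hL₂
    set L := (lipGrad ∞ f).toReal with hL
    have hL₂0 : 0 ≤ L₂ := ENNReal.toReal_nonneg
    have hL0 : 0 < L := ENNReal.toReal_pos hzero htop.2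
    have eL₂ : lipGrad 2 f = ENNReal.ofReal L₂ := (ENNReal.ofReal_toReal htop.1).symm
    have eL : lipGrad ∞ f = ENNReal.ofReal L := (ENNReal.ofReal_toReal htop.2).symm
    have hbL : ∀ i x, partialDeriv f i x ^ 2 ≤ L ^ 2 := by
      intro i x
      have h := sq_le_toReal_of_enorm_rpow_le (a := partialDeriv f i x)
        (b := lipGrad ∞ f ^ (2 : ℝ)) (by simp [htop.2])
        (ENNReal.rpow_le_rpow (enorm_partialDeriv_le_lipGrad_top i x) (by norm_num))
      rwa [ENNReal.rpow_two, ENNReal.toReal_pow] at h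
    have hS : ∀ x, ∑ i, partialDeriv f i x ^ 2 ≤ L₂ ^ 2 := by
      intro x
      have h := sum_rpow_le_lipGrad_two_sq (f := f) x
      simp_rw [ENNReal.rpow_two, ← ofReal_norm, ← ENNReal.ofReal_pow (norm_nonneg _)] at h
      rw [← ENNReal.ofReal_sum_of_nonneg fun i _ => by positivity, eL₂,
        ← ENNReal.ofReal_pow hL₂0, ENNReal.ofReal_le_ofReal_iff (by positivity)] at h
      simpa using h
    have hmain := median_tail_lipGrad hq0 hq1 hf hT hTd hm' hL₂0 hL0 hbL hS ht ht2 hC hC2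
    refine le_trans (le_of_eq ?_) hmain
    rw [← htail]
    congr 1
    ext ω
    simp only [Set.mem_ofPred_eq]
    rw [eL₂, eL, ← ENNReal.ofReal_mul ht.le, ← ENNReal.ofReal_mul (by positivity),
      ← ENNReal.ofReal_add (by positivity) (by positivity), ← ENNReal.ofReal_mul hfac.le,
      ENNReal.ofReal_lt_ofReal_iff_of_nonneg (by positivity)]
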